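/- There exists a universal constant C > 0 (independent of ε and F) such that for every ε > 0, every F ∈ (1, ∞), every choice of sign ±, and every Schwartz function g on ℝ³, the function u(t,x) = ∫_{ℝ³} exp(i x·ξ ± i (t/ε) p_F(ξ)) ĝ(ξ) dξ satisfies ‖u‖_{L⁶(ℝ_t × ℝ³_x)} ≤ C ε^{1/6} F^{1/2} (F − 1)^{−1/6} ‖g‖_{Ḣ¹}. -/

import Mathlib

open MeasureTheory Complex
open scoped ENNReal RealInnerProductSpace

noncomputable section

/-- Fourier transform `f̂(ξ) = ∫ e^{-i x·ξ} f(x) dx` on `ℝⁿ`. -/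
def fourierTf {n : ℕ} (f : EuclideanSpace ℝ (Fin n) → ℂ) (ξ : EuclideanSpace ℝ (Fin n)) : ℂ :=
  ∫ x : EuclideanSpace ℝ (Fin n), Complex.exp (-Complex.I * Complex.ofReal ⟪x, ξ⟫) * f x

/-- Homogeneous Sobolev norm `‖f‖_{Ḣˢ}` on `ℝⁿ`. -/
def sobolevNorm {n : ℕ} (s : ℝ) (f : EuclideanSpace ℝ (Fin n) → ℂ) : ℝ :=
  (∫ ξ : EuclideanSpace ℝ (Fin n), ‖ξ‖ ^ (2 * s) * ‖fourierTf f ξ‖ ^ 2) ^ (1 / 2 : ℝ)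

/-- The dispersion relation `p_F(ξ) = |ξ|_F / (F |ξ|)`. -/
def pF (F : ℝ) (ξ : EuclideanSpace ℝ (Fin 3)) : ℝ :=
  Real.sqrt ((ξ 0) ^ 2 + (ξ 1) ^ 2 + (F * ξ 2) ^ 2) / (F * ‖ξ‖)

lemma radial_bound {m : ℝ} (hm : 0 < m) (I : Set ℝ) (hI : I.OrdConnected) (h0 : (0:ℝ) ∈ I)
    (hI0 : ∀ r ∈ I, 0 ≤ r) (ψ ψ1 ψ2 : ℝ → ℝ)
    (h1 : ∀ r ∈ I, HasDerivAt ψ (ψ1 r) r) (h2 : ∀ r ∈ I, HasDerivAt ψ1 (ψ2 r) r)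
    (hmin : ∀ r ∈ I, ψ 0 ≤ ψ r) (hpos : ∀ r ∈ I, m ≤ ψ2 r) (h : ℝ → ℝ≥0∞) :
    ∫⁻ r in I, ENNReal.ofReal r * h (ψ r) ≤ ENNReal.ofReal (1 / m) * ∫⁻ y, h y := by
  have hconv : Convex ℝ I := convex_iff_ordConnected.2 hI
  have hmono : MonotoneOn (fun r => ψ1 r - m * r) I := by
    apply monotoneOn_of_deriv_nonneg hconv
    · intro r hr
      exact (((h2 r hr).continuousAt).sub (by fun_prop)).continuousWithinAt
    · intro r hr
      have := ((h2 r (interior_subset hr)).sub ((hasDerivAt_id r).const_mul m))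
      exact this.differentiableAt.differentiableWithinAt
    · intro r hr
      have := ((h2 r (interior_subset hr)).sub ((hasDerivAt_id r).const_mul m))
      have e : deriv (fun r => ψ1 r - m * r) r = ψ2 r - m * 1 := this.deriv
      rw [e]; linarith [hpos r (interior_subset hr)]
  -- if I has a positive point then ψ1 0 ≥ 0
  have hd : ∀ r ∈ I, 0 < r → m * r ≤ ψ1 r := by
    intro r hr hr0
    have hz : 0 ≤ ψ1 0 := by
      have hh := (h1 0 h0).hasDerivWithinAt (s := Set.Ioi 0)
      rw [hasDerivWithinAt_iff_tendsto_slope' (by simp)] at hh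
      apply ge_of_tendsto hh
      have : Set.Ioo 0 r ∈ nhdsWithin (0:ℝ) (Set.Ioi 0) := Ioo_mem_nhdsGT hr0
      filter_upwards [this] with s hs
      have hsI : s ∈ I := hI.out h0 hr ⟨hs.1.le, hs.2.le⟩
      rw [slope_def_field]
      apply div_nonneg
      · linarith [hmin s hsI]
      · linarith [hs.1]
    have := hmono h0 hr hr0.le
    simp only at this
    linarith
  have hinj : StrictMonoOn ψ I := by
    apply strictMonoOn_of_deriv_pos hconv
    · intro r hr
      exact (h1 r hr).continuousAt.continuousWithinAt
    · intro r hr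
      rw [(h1 r (interior_subset hr)).deriv]
      have hr0 : 0 < r := by
        rcases (hI0 r (interior_subset hr)).lt_or_eq with h | h
        · exact h
        · exfalso
          have hn := mem_interior_iff_mem_nhds.1 hr
          rw [← h] at hn
          obtain ⟨δ, hδ, hb⟩ := Metric.mem_nhds_iff.1 hn
          have := hI0 (-(δ/2)) (hb (by simp [abs_of_pos hδ]; linarith))
          linarith
      have := hd r (interior_subset hr) hr0
      nlinarith
  have hIm : MeasurableSet I := hI.measurableSet
  have key := lintegral_image_eq_lintegral_abs_deriv_mul hIm
    (fun r hr => (h1 r hr).hasDerivWithinAt) hinj.injOn h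
  calc ∫⁻ r in I, ENNReal.ofReal r * h (ψ r)
      ≤ ∫⁻ r in I, ENNReal.ofReal (1/m) * (ENNReal.ofReal |ψ1 r| * h (ψ r)) := by
        apply setLIntegral_mono_ae' hIm
        refine Filter.Eventually.of_forall (fun r hr => ?_)
        rw [← mul_assoc, ← ENNReal.ofReal_mul (by positivity)]
        gcongr
        rcases (hI0 r hr).lt_or_eq with h | h
        · have := hd r hr h
          rw [one_div, ← div_eq_inv_mul, le_div_iff₀ hm]
          calc r * m = m * r := mul_comm _ _
            _ ≤ ψ1 r := this
            _ ≤ _ := le_abs_self _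
        · rw [← h]; positivity
    _ = ENNReal.ofReal (1/m) * ∫⁻ r in I, (ENNReal.ofReal |ψ1 r| * h (ψ r)) := by
        rw [lintegral_const_mul' _ _ ENNReal.ofReal_ne_top]
    _ ≤ _ := by
        rw [← key]
        gcongr
        exact Measure.restrict_le_self

lemma planar_bound {m : ℝ} (hm : 0 < m) (D : Set (ℝ × ℝ)) (hc : IsCompact D) (hconv : Convex ℝ D)
    (Φ : ℝ × ℝ → ℝ) (D1 D2 : ℝ × ℝ → ℝ × ℝ → ℝ) (hcont : ContinuousOn Φ D)
    (h1 : ∀ v ∈ D, ∀ ω : ℝ × ℝ, HasDerivAt (fun r : ℝ => Φ (v + r • ω)) (D1 v ω) 0)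
    (h2 : ∀ v ∈ D, ∀ ω : ℝ × ℝ, HasDerivAt (fun r : ℝ => D1 (v + r • ω) ω) (D2 v ω) 0)
    (hpos : ∀ v ∈ D, ∀ ω : ℝ × ℝ, m * (ω.1 ^ 2 + ω.2 ^ 2) ≤ D2 v ω) (h : ℝ → ℝ≥0∞) :
    ∫⁻ v in D, h (Φ v) ≤ ENNReal.ofReal (2 * Real.pi / m) * ∫⁻ y, h y := by
  rcases D.eq_empty_or_nonempty with rfl | hne
  · simp
  obtain ⟨v0, hv0, hv⟩ := hc.exists_isMinOn hne hcont
  have hDm : MeasurableSet D := hc.measurableSet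
  have shift : ∀ (v ω : ℝ × ℝ) (r : ℝ) (g : ℝ × ℝ → ℝ) (g' : ℝ),
      HasDerivAt (fun s : ℝ => g (v + r • ω + s • ω)) g' 0 →
      HasDerivAt (fun s : ℝ => g (v + s • ω)) g' r := by
    intro v ω r g g' hg
    have : HasDerivAt (fun s : ℝ => g (v + r • ω + s • ω)) g' (r - r) := by simpa using hg
    have h3 := HasDerivAt.comp_sub_const r r this
    refine h3.congr_of_eventuallyEq (Filter.Eventually.of_forall (fun s => ?_))
    simp only
    congr 1
    rw [sub_smul]; abel
  set f : ℝ × ℝ → ℝ≥0∞ := fun w => D.indicator (fun v => h (Φ v)) (v0 + w) with hf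
  have e1 : ∫⁻ v in D, h (Φ v) = ∫⁻ w, f w := by
    rw [← lintegral_indicator hDm, hf]
    rw [lintegral_add_left_eq_self (μ := (volume : Measure (ℝ × ℝ))) (fun w => D.indicator (fun v => h (Φ v)) w) v0]
  rw [e1, ← lintegral_comp_polarCoord_symm]
  have hray : ∀ θ : ℝ, ∫⁻ r in Set.Ioi (0:ℝ), ENNReal.ofReal r • f (r * Real.cos θ, r * Real.sin θ)
      ≤ ENNReal.ofReal (1/m) * ∫⁻ y, h y := by
    intro θ
    set ω : ℝ × ℝ := (Real.cos θ, Real.sin θ) with hω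
    set I : Set ℝ := {r | 0 ≤ r ∧ v0 + r • ω ∈ D} with hI
    have hIo : I.OrdConnected := by
      apply convex_iff_ordConnected.1
      have : I = Set.Ici 0 ∩ (fun r : ℝ => v0 + r • ω) ⁻¹' D := by ext; simp [hI]
      rw [this]
      apply (convex_Ici 0).inter
      intro a ha b hb s t hs ht hst
      have := hconv ha hb hs ht hst
      simp only [Set.mem_preimage]
      convert this using 1
      obtain rfl : t = 1 - s := by linarith
      simp only [smul_eq_mul]
      module
    have hIm : MeasurableSet I := hIo.measurableSet
    have key := radial_bound hm I hIo ⟨le_refl _, by simpa using hv0⟩ (fun r hr => hr.1)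
      (fun r => Φ (v0 + r • ω)) (fun r => D1 (v0 + r • ω) ω) (fun r => D2 (v0 + r • ω) ω)
      (fun r hr => shift v0 ω r Φ _ (h1 _ hr.2 ω))
      (fun r hr => shift v0 ω r (fun v => D1 v ω) _ (h2 _ hr.2 ω))
      (fun r hr => by simpa using hv hr.2)
      (fun r hr => by
        have := hpos _ hr.2 ω
        simp only [hω, Real.cos_sq_add_sin_sq, mul_one] at this
        exact this) h
    refine le_trans ?_ key
    rw [← lintegral_indicator hIm, ← lintegral_indicator measurableSet_Ioi]
    apply lintegral_mono
    intro r
    by_cases hr : r ∈ Set.Ioi (0:ℝ)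
    · simp only [Set.indicator_of_mem hr, hf]
      by_cases hr2 : v0 + (r * Real.cos θ, r * Real.sin θ) ∈ D
      · rw [Set.indicator_of_mem hr2]
        have : r ∈ I := ⟨le_of_lt hr, by simpa [hω] using hr2⟩
        rw [Set.indicator_of_mem this]
        simp [hω]
      · simp [Set.indicator_of_notMem hr2]
    · simp [Set.indicator_of_notMem hr]
  have hswap : ∫⁻ p in polarCoord.target, ENNReal.ofReal p.1 • f (polarCoord.symm p)
      ≤ ∫⁻ θ in Set.Ioo (-Real.pi) Real.pi, ∫⁻ r in Set.Ioi (0:ℝ),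
        ENNReal.ofReal r • f (r * Real.cos θ, r * Real.sin θ) := by
    have : (volume : Measure (ℝ × ℝ)).restrict polarCoord.target
        = (volume.restrict (Set.Ioi (0:ℝ))).prod (volume.restrict (Set.Ioo (-Real.pi) Real.pi)) := by
      rw [Measure.prod_restrict]; rfl
    rw [this, ← Measure.prod_swap]
    have e : (Prod.swap : ℝ × ℝ → ℝ × ℝ) = MeasurableEquiv.prodComm := rfl
    rw [e, lintegral_map_equiv]
    refine le_trans (lintegral_prod_le _) ?_
    rfl
  refine hswap.trans ?_
  calc _ ≤ ∫⁻ θ in Set.Ioo (-Real.pi) Real.pi, ENNReal.ofReal (1/m) * ∫⁻ y, h y :=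
        lintegral_mono (fun θ => hray θ)
    _ = _ := by
      rw [lintegral_const, Measure.restrict_apply_univ, Real.volume_Ioo, mul_right_comm,
        ← ENNReal.ofReal_mul (by positivity)]
      congr 2; ring

/-- Euclidean three-space. -/
abbrev E3 := EuclideanSpace ℝ (Fin 3)

/-- `q` is twice differentiable along `e` at the points of `Q`, with second derivative `≥ κ`. -/
def ConvexAlong (q q1 q2 : E3 → ℝ) (e : E3) (Q : Set E3) (κ : ℝ) : Prop :=
  ∀ ξ ∈ Q, HasDerivAt (fun s : ℝ => q (ξ + s • e)) (q1 ξ) 0 ∧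
    HasDerivAt (fun s : ℝ => q1 (ξ + s • e)) (q2 ξ) 0 ∧ κ ≤ q2 ξ

lemma hasDerivAt_scale (q : E3 → ℝ) (ξ e : E3) (d c : ℝ)
    (h : HasDerivAt (fun s : ℝ => q (ξ + s • e)) d 0) :
    HasDerivAt (fun r : ℝ => q (ξ + (r * c) • e)) (c * d) 0 := by
  have h1 : HasDerivAt (fun r : ℝ => r * c) c 0 := by
    simpa using (hasDerivAt_id (0:ℝ)).mul_const c
  have h2 : HasDerivAt (fun s : ℝ => q (ξ + s • e)) d ((fun r : ℝ => r * c) 0) := by simpa using h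
  have := h2.comp (0:ℝ) h1
  rw [mul_comm]
  exact this

lemma line_bound {m N1 N2 : ℝ} (hm : 0 < m) (hN1 : 0 < N1) (hN2 : 0 < N2)
    (q q1 q2 : E3 → ℝ) (e : E3) (Q1 Q2 Q3 : Set E3)
    (hc1 : IsClosed Q1) (hc2 : IsClosed Q2) (hc3 : IsClosed Q3)
    (hv1 : Convex ℝ Q1) (hv2 : Convex ℝ Q2) (hv3 : Convex ℝ Q3)
    (hq1 : ContinuousOn q Q1) (hq2 : ContinuousOn q Q2) (hq3 : ContinuousOn q Q3)
    (hd1 : ConvexAlong q q1 q2 e Q1 (m / N1 ^ 2)) (hd2 : ConvexAlong q q1 q2 e Q2 (m / N2 ^ 2))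
    (hd3 : ConvexAlong q q1 q2 e Q3 0) (h : ℝ → ℝ≥0∞) (ξ1 ξ2 η : E3) :
    ∫⁻ w in Set.Icc (0:ℝ) 1 ×ˢ Set.Icc (0:ℝ) 1,
      Q1.indicator (fun _ => (1:ℝ≥0∞)) (ξ1 + (w.1 * N1) • e) *
      Q2.indicator (fun _ => (1:ℝ≥0∞)) (ξ2 + (w.2 * N2) • e) *
      Q3.indicator (fun _ => (1:ℝ≥0∞)) (η - (ξ1 + (w.1 * N1) • e) - (ξ2 + (w.2 * N2) • e)) *
      h (q (ξ1 + (w.1 * N1) • e) + q (ξ2 + (w.2 * N2) • e) +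
        q (η - (ξ1 + (w.1 * N1) • e) - (ξ2 + (w.2 * N2) • e)))
      ≤ ENNReal.ofReal (2 * Real.pi / m) * ∫⁻ y, h y := by
  set a1 : ℝ × ℝ → E3 := fun w => ξ1 + (w.1 * N1) • e with ha1
  set a2 : ℝ × ℝ → E3 := fun w => ξ2 + (w.2 * N2) • e with ha2
  set a3 : ℝ × ℝ → E3 := fun w => η - (ξ1 + (w.1 * N1) • e) - (ξ2 + (w.2 * N2) • e) with ha3
  have ca1 : Continuous a1 := by rw [ha1]; fun_prop
  have ca2 : Continuous a2 := by rw [ha2]; fun_prop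
  have ca3 : Continuous a3 := by rw [ha3]; fun_prop
  set B : Set (ℝ × ℝ) := Set.Icc (0:ℝ) 1 ×ˢ Set.Icc (0:ℝ) 1 with hB
  set D : Set (ℝ × ℝ) := B ∩ (a1 ⁻¹' Q1 ∩ (a2 ⁻¹' Q2 ∩ a3 ⁻¹' Q3)) with hD
  have hBc : IsCompact B := isCompact_Icc.prod isCompact_Icc
  have hDc : IsCompact D := hBc.inter_right
    ((hc1.preimage ca1).inter ((hc2.preimage ca2).inter (hc3.preimage ca3)))
  have aff : ∀ (a : ℝ × ℝ → E3) (Q : Set E3), Convex ℝ Q →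
      (∀ v w : ℝ × ℝ, ∀ s : ℝ, a (s • v + (1 - s) • w) = s • a v + (1 - s) • a w) →
      Convex ℝ (a ⁻¹' Q) := by
    intro a Q hQ ha v hv w hw s t hs ht hst
    obtain rfl : t = 1 - s := by linarith
    rw [Set.mem_preimage, ha]
    exact hQ hv hw hs ht hst
  have hDv : Convex ℝ D := by
    refine ((convex_Icc 0 1).prod (convex_Icc 0 1)).inter ((aff a1 Q1 hv1 ?_).inter
      ((aff a2 Q2 hv2 ?_).inter (aff a3 Q3 hv3 ?_)))
    · intro v w s; simp only [ha1, Prod.fst_add, Prod.smul_fst, smul_eq_mul]; module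
    · intro v w s; simp only [ha2, Prod.snd_add, Prod.smul_snd, smul_eq_mul]; module
    · intro v w s
      simp only [ha3, Prod.snd_add, Prod.smul_snd, Prod.fst_add, Prod.smul_fst, smul_eq_mul]; module
  have e1 : ∀ (v ω : ℝ × ℝ) (r : ℝ), a1 (v + r • ω) = a1 v + (r * (ω.1 * N1)) • e := by
    intro v ω r; simp only [ha1, Prod.fst_add, Prod.smul_fst, smul_eq_mul]; module
  have e2 : ∀ (v ω : ℝ × ℝ) (r : ℝ), a2 (v + r • ω) = a2 v + (r * (ω.2 * N2)) • e := by
    intro v ω r; simp only [ha2, Prod.snd_add, Prod.smul_snd, smul_eq_mul]; module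
  have e3 : ∀ (v ω : ℝ × ℝ) (r : ℝ),
      a3 (v + r • ω) = a3 v + (r * (-(ω.1 * N1 + ω.2 * N2))) • e := by
    intro v ω r
    simp only [ha3, Prod.snd_add, Prod.smul_snd, Prod.fst_add, Prod.smul_fst, smul_eq_mul]; module
  have key := planar_bound hm D hDc hDv (fun v => q (a1 v) + q (a2 v) + q (a3 v))
    (fun v ω => (ω.1 * N1) * q1 (a1 v) + (ω.2 * N2) * q1 (a2 v) +
      (-(ω.1 * N1 + ω.2 * N2)) * q1 (a3 v))
    (fun v ω => (ω.1 * N1) * ((ω.1 * N1) * q2 (a1 v)) + (ω.2 * N2) * ((ω.2 * N2) * q2 (a2 v)) +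
      (-(ω.1 * N1 + ω.2 * N2)) * ((-(ω.1 * N1 + ω.2 * N2)) * q2 (a3 v)))
    ?_ ?_ ?_ ?_ h
  · refine le_trans ?_ key
    rw [← lintegral_indicator hDc.measurableSet, ← lintegral_indicator hBc.measurableSet]
    apply lintegral_mono
    intro w
    by_cases hw : w ∈ D
    · have hwB : w ∈ B := hw.1
      have i1 : a1 w ∈ Q1 := hw.2.1
      have i2 : a2 w ∈ Q2 := hw.2.2.1
      have i3 : a3 w ∈ Q3 := hw.2.2.2
      simp only [ha1] at i1; simp only [ha2] at i2; simp only [ha3] at i3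
      simp [Set.indicator_of_mem hw, Set.indicator_of_mem hwB, i1, i2, i3, ha1, ha2, ha3]
    · rw [Set.indicator_of_notMem hw]
      by_cases hwB : w ∈ B
      · rw [Set.indicator_of_mem hwB]
        by_cases i1 : a1 w ∈ Q1
        · by_cases i2 : a2 w ∈ Q2
          · by_cases i3 : a3 w ∈ Q3
            · exact absurd ⟨hwB, i1, i2, i3⟩ hw
            · simp only [ha3] at i3; simp [i3]
          · simp only [ha2] at i2; simp [i2]
        · simp only [ha1] at i1; simp [i1]
      · rw [Set.indicator_of_notMem hwB]
  · refine ((hq1.comp ca1.continuousOn ?_).add (hq2.comp ca2.continuousOn ?_)).add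
      (hq3.comp ca3.continuousOn ?_)
    · exact fun w hw => hw.2.1
    · exact fun w hw => hw.2.2.1
    · exact fun w hw => hw.2.2.2
  · intro v hv ω
    simp only [e1, e2, e3]
    exact ((hasDerivAt_scale q _ _ _ _ (hd1 _ hv.2.1).1).add
      (hasDerivAt_scale q _ _ _ _ (hd2 _ hv.2.2.1).1)).add
      (hasDerivAt_scale q _ _ _ _ (hd3 _ hv.2.2.2).1)
  · intro v hv ω
    simp only [e1, e2, e3]
    exact (((hasDerivAt_scale q1 _ _ _ _ (hd1 _ hv.2.1).2.1).const_mul _).add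
      ((hasDerivAt_scale q1 _ _ _ _ (hd2 _ hv.2.2.1).2.1).const_mul _)).add
      ((hasDerivAt_scale q1 _ _ _ _ (hd3 _ hv.2.2.2).2.1).const_mul _)
  · intro v hv ω
    have b1 := (hd1 _ hv.2.1).2.2
    have b2 := (hd2 _ hv.2.2.1).2.2
    have b3 := (hd3 _ hv.2.2.2).2.2
    have c1 : m * ω.1 ^ 2 ≤ (ω.1 * N1) * ((ω.1 * N1) * q2 (a1 v)) := by
      calc m * ω.1 ^ 2 = (ω.1 * N1) ^ 2 * (m / N1 ^ 2) := by field_simp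
        _ ≤ (ω.1 * N1) ^ 2 * q2 (a1 v) := by gcongr
        _ = _ := by ring
    have c2 : m * ω.2 ^ 2 ≤ (ω.2 * N2) * ((ω.2 * N2) * q2 (a2 v)) := by
      calc m * ω.2 ^ 2 = (ω.2 * N2) ^ 2 * (m / N2 ^ 2) := by field_simp
        _ ≤ (ω.2 * N2) ^ 2 * q2 (a2 v) := by gcongr
        _ = _ := by ring
    have c3 : 0 ≤ (-(ω.1 * N1 + ω.2 * N2)) * ((-(ω.1 * N1 + ω.2 * N2)) * q2 (a3 v)) := by
      have := mul_nonneg (sq_nonneg (ω.1 * N1 + ω.2 * N2)) b3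
      calc 0 ≤ _ := this
        _ = _ := by ring
    linarith

/-- Volume of the unit ball. -/
def vB : ℝ≥0∞ := (volume : Measure E3) (Metric.ball 0 1)

lemma vol_ball (r : ℝ) (hr : 0 ≤ r) :
    (volume : Measure E3) (Metric.closedBall 0 r) = ENNReal.ofReal (r ^ 3) * vB := by
  rw [Measure.addHaar_closedBall _ _ hr]
  simp [vB]

lemma fiber_bound {m N1 N2 R : ℝ} (hm : 0 < m) (hN1 : 0 < N1) (hN2 : 0 < N2) (hR : 0 < R)
    (q q1 q2 : E3 → ℝ) (hqm : Measurable q) (e : E3) (he : ‖e‖ ≤ R) (Q1 Q2 Q3 : Set E3)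
    (hc1 : IsClosed Q1) (hc2 : IsClosed Q2) (hc3 : IsClosed Q3)
    (hv1 : Convex ℝ Q1) (hv2 : Convex ℝ Q2) (hv3 : Convex ℝ Q3)
    (hq1 : ContinuousOn q Q1) (hq2 : ContinuousOn q Q2) (hq3 : ContinuousOn q Q3)
    (hd1 : ConvexAlong q q1 q2 e Q1 (m / N1 ^ 2)) (hd2 : ConvexAlong q q1 q2 e Q2 (m / N2 ^ 2))
    (hd3 : ConvexAlong q q1 q2 e Q3 0)
    (hb1 : ∀ ξ ∈ Q1, ‖ξ‖ ≤ R * N1) (hb2 : ∀ ξ ∈ Q2, ‖ξ‖ ≤ R * N2)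
    (h : ℝ → ℝ≥0∞) (hh : Measurable h) (η : E3) :
    ∫⁻ z : E3 × E3, Q1.indicator (fun _ => (1:ℝ≥0∞)) z.1 * Q2.indicator (fun _ => (1:ℝ≥0∞)) z.2 *
      Q3.indicator (fun _ => (1:ℝ≥0∞)) (η - z.1 - z.2) * h (q z.1 + q z.2 + q (η - z.1 - z.2))
      ≤ ENNReal.ofReal ((2 * R) ^ 6 * (2 * Real.pi) * (N1 ^ 3 * N2 ^ 3 / m)) * vB ^ 2 * ∫⁻ y, h y := by
  set G : E3 × E3 → ℝ≥0∞ := fun z => Q1.indicator (fun _ => (1:ℝ≥0∞)) z.1 *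
    Q2.indicator (fun _ => (1:ℝ≥0∞)) z.2 *
      Q3.indicator (fun _ => (1:ℝ≥0∞)) (η - z.1 - z.2) * h (q z.1 + q z.2 + q (η - z.1 - z.2)) with hG
  have m1 : Measurable (Q1.indicator (fun _ => (1:ℝ≥0∞))) := measurable_const.indicator hc1.measurableSet
  have m2 : Measurable (Q2.indicator (fun _ => (1:ℝ≥0∞))) := measurable_const.indicator hc2.measurableSet
  have m3 : Measurable (Q3.indicator (fun _ => (1:ℝ≥0∞))) := measurable_const.indicator hc3.measurableSet
  have hGm : Measurable G := by
    have : Measurable (fun z : E3 × E3 => η - z.1 - z.2) := by fun_prop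
    exact (((m1.comp measurable_fst).mul (m2.comp measurable_snd)).mul (m3.comp this)).mul
      (hh.comp (((hqm.comp measurable_fst).add (hqm.comp measurable_snd)).add (hqm.comp this)))
  set B : Set (ℝ × ℝ) := Set.Icc (0:ℝ) 1 ×ˢ Set.Icc (0:ℝ) 1 with hB
  have hvB : (volume : Measure (ℝ × ℝ)) B = 1 := by
    rw [hB, Measure.volume_eq_prod, Measure.prod_prod]; simp
  have step1 : ∫⁻ z, G z = ∫⁻ w in B, ∫⁻ z : E3 × E3,
      G (z.1 + (w.1 * N1) • e, z.2 + (w.2 * N2) • e) := by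
    have : ∀ w : ℝ × ℝ, ∫⁻ z : E3 × E3,
      G (z.1 + (w.1 * N1) • e, z.2 + (w.2 * N2) • e) = ∫⁻ z, G z := by
      intro w
      exact lintegral_add_right_eq_self (μ := (volume : Measure E3).prod (volume : Measure E3)) G
        ((w.1 * N1) • e, (w.2 * N2) • e)
    simp_rw [this]
    rw [lintegral_const, Measure.restrict_apply_univ, hvB, mul_one]
  rw [step1, lintegral_lintegral_swap]
  swap
  · apply Measurable.aemeasurable
    apply hGm.comp
    fun_prop
  set S1 := Metric.closedBall (0:E3) (2 * R * N1)
  set S2 := Metric.closedBall (0:E3) (2 * R * N2)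
  have inS : ∀ (N : ℝ) (hN : 0 < N) (Q : Set E3) (hb : ∀ ξ ∈ Q, ‖ξ‖ ≤ R * N) (ξ : E3) (s : ℝ),
      s ∈ Set.Icc (0:ℝ) 1 → ξ + (s * N) • e ∈ Q → ξ ∈ Metric.closedBall (0:E3) (2 * R * N) := by
    intro N hN Q hb ξ s hs hmem
    have h1 := hb _ hmem
    have h2 : ‖(s * N) • e‖ ≤ N * R := by
      rw [norm_smul, Real.norm_eq_abs, abs_of_nonneg (mul_nonneg hs.1 hN.le)]
      have : s * N ≤ N := by nlinarith [hs.2]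
      gcongr
    have h3 : ‖ξ‖ ≤ ‖ξ + (s * N) • e‖ + ‖(s * N) • e‖ := by
      have := norm_sub_le (ξ + (s * N) • e) ((s * N) • e)
      simpa using this
    rw [mem_closedBall_zero_iff]
    linarith
  calc ∫⁻ z : E3 × E3, ∫⁻ w in B, G (z.1 + (w.1 * N1) • e, z.2 + (w.2 * N2) • e)
      ≤ ∫⁻ z : E3 × E3, (S1 ×ˢ S2).indicator
        (fun _ => ENNReal.ofReal (2 * Real.pi / m) * ∫⁻ y, h y) z := by
        apply lintegral_mono
        intro z
        by_cases hz : z ∈ S1 ×ˢ S2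
        · rw [Set.indicator_of_mem hz]
          exact line_bound hm hN1 hN2 q q1 q2 e Q1 Q2 Q3 hc1 hc2 hc3 hv1 hv2 hv3 hq1 hq2 hq3 hd1 hd2
            hd3 h z.1 z.2 η
        · rw [Set.indicator_of_notMem hz]
          simp only [nonpos_iff_eq_zero]
          apply setLIntegral_eq_zero (isCompact_Icc.prod isCompact_Icc).measurableSet
          intro w hw
          simp only [hG, Pi.zero_apply]
          by_cases i1 : z.1 + (w.1 * N1) • e ∈ Q1
          · by_cases i2 : z.2 + (w.2 * N2) • e ∈ Q2
            · exact absurd ⟨inS N1 hN1 Q1 hb1 _ _ hw.1 i1, inS N2 hN2 Q2 hb2 _ _ hw.2 i2⟩ hz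
            · simp [i2]
          · simp [i1]
    _ = (ENNReal.ofReal (2 * Real.pi / m) * ∫⁻ y, h y) * (volume S1 * volume S2) := by
        rw [lintegral_indicator (measurableSet_closedBall.prod measurableSet_closedBall),
          setLIntegral_const, Measure.volume_eq_prod, Measure.prod_prod]
    _ = _ := by
        rw [vol_ball _ (by positivity), vol_ball _ (by positivity)]
        have : ENNReal.ofReal ((2 * R) ^ 6 * (2 * Real.pi) * (N1 ^ 3 * N2 ^ 3 / m))
          = ENNReal.ofReal (2 * Real.pi / m) * (ENNReal.ofReal ((2 * R * N1) ^ 3) *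
            ENNReal.ofReal ((2 * R * N2) ^ 3)) := by
          rw [← ENNReal.ofReal_mul (by positivity), ← ENNReal.ofReal_mul (by positivity)]
          congr 1; ring
        rw [this]; ring

lemma push_bound {m N1 N2 R : ℝ} (hm : 0 < m) (hN1 : 0 < N1) (hN2 : 0 < N2) (hR : 0 < R)
    (q q1 q2 : E3 → ℝ) (hqm : Measurable q) (e : E3) (he : ‖e‖ ≤ R) (Q1 Q2 Q3 : Set E3)
    (hc1 : IsClosed Q1) (hc2 : IsClosed Q2) (hc3 : IsClosed Q3)
    (hv1 : Convex ℝ Q1) (hv2 : Convex ℝ Q2) (hv3 : Convex ℝ Q3)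
    (hq1 : ContinuousOn q Q1) (hq2 : ContinuousOn q Q2) (hq3 : ContinuousOn q Q3)
    (hd1 : ConvexAlong q q1 q2 e Q1 (m / N1 ^ 2)) (hd2 : ConvexAlong q q1 q2 e Q2 (m / N2 ^ 2))
    (hd3 : ConvexAlong q q1 q2 e Q3 0)
    (hb1 : ∀ ξ ∈ Q1, ‖ξ‖ ≤ R * N1) (hb2 : ∀ ξ ∈ Q2, ‖ξ‖ ≤ R * N2)
    (H : ℝ × E3 → ℝ≥0∞) (hH : Measurable H) :
    ∫⁻ z : E3 × E3 × E3, H (q z.1 + q z.2.1 + q z.2.2, z.1 + z.2.1 + z.2.2)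
      ∂((volume.restrict Q1).prod ((volume.restrict Q2).prod (volume.restrict Q3)))
      ≤ ENNReal.ofReal ((2 * R) ^ 6 * (2 * Real.pi) * (N1 ^ 3 * N2 ^ 3 / m)) * vB ^ 2 * ∫⁻ y, H y := by
  set A := ENNReal.ofReal ((2 * R) ^ 6 * (2 * Real.pi) * (N1 ^ 3 * N2 ^ 3 / m)) * vB ^ 2
  have m1 : Measurable (Q1.indicator (fun _ => (1:ℝ≥0∞))) := measurable_const.indicator hc1.measurableSet
  have m2 : Measurable (Q2.indicator (fun _ => (1:ℝ≥0∞))) := measurable_const.indicator hc2.measurableSet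
  have m3 : Measurable (Q3.indicator (fun _ => (1:ℝ≥0∞))) := measurable_const.indicator hc3.measurableSet
  set W : E3 × E3 × E3 → ℝ≥0∞ := fun z => Q1.indicator (fun _ => (1:ℝ≥0∞)) z.1 *
    Q2.indicator (fun _ => (1:ℝ≥0∞)) z.2.1 * Q3.indicator (fun _ => (1:ℝ≥0∞)) z.2.2 *
    H (q z.1 + q z.2.1 + q z.2.2, z.1 + z.2.1 + z.2.2) with hW
  have hWm : Measurable W := by
    apply Measurable.mul
    · exact ((m1.comp measurable_fst).mul (m2.comp (measurable_fst.comp measurable_snd))).mul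
        (m3.comp (measurable_snd.comp measurable_snd))
    · apply hH.comp
      fun_prop
  have s1 : ∫⁻ z : E3 × E3 × E3, H (q z.1 + q z.2.1 + q z.2.2, z.1 + z.2.1 + z.2.2)
      ∂((volume.restrict Q1).prod ((volume.restrict Q2).prod (volume.restrict Q3)))
      = ∫⁻ z, W z := by
    rw [Measure.prod_restrict, Measure.prod_restrict, ← Measure.volume_eq_prod,
      ← Measure.volume_eq_prod, ← lintegral_indicator
        (hc1.measurableSet.prod (hc2.measurableSet.prod hc3.measurableSet))]
    congr 1
    ext z
    by_cases i1 : z.1 ∈ Q1 <;> by_cases i2 : z.2.1 ∈ Q2 <;> by_cases i3 : z.2.2 ∈ Q3 <;>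
      simp [hW, Set.indicator, i1, i2, i3]
  have s2 : ∫⁻ z, W z = ∫⁻ z : E3 × E3, ∫⁻ η : E3, W (z.1, z.2, η - z.1 - z.2) := by
    rw [Measure.volume_eq_prod, lintegral_prod _ hWm.aemeasurable]
    rw [Measure.volume_eq_prod, lintegral_prod _ (by
      apply Measurable.aemeasurable
      apply Measurable.lintegral_prod_right
      exact hWm.comp (by fun_prop))]
    congr 1
    ext ξ1
    rw [lintegral_prod _ (by
      apply Measurable.aemeasurable
      exact hWm.comp (by fun_prop))]
    congr 1
    ext ξ2
    simp only
    have := lintegral_sub_right_eq_self (μ := (volume : Measure E3)) (fun η => W (ξ1, ξ2, η)) (ξ1 + ξ2)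
    rw [← this]
    congr 1
    ext η
    rw [sub_sub]
  rw [s1, s2, lintegral_lintegral_swap (by
      apply Measurable.aemeasurable
      exact hWm.comp (by fun_prop))]
  calc ∫⁻ η : E3, ∫⁻ z : E3 × E3, W (z.1, z.2, η - z.1 - z.2)
      ≤ ∫⁻ η : E3, A * ∫⁻ y, H (y, η) := by
        apply lintegral_mono
        intro η
        have := fiber_bound hm hN1 hN2 hR q q1 q2 hqm e he Q1 Q2 Q3 hc1 hc2 hc3 hv1 hv2 hv3 hq1 hq2 hq3
          hd1 hd2 hd3 hb1 hb2 (fun y => H (y, η)) (hH.comp (by fun_prop)) η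
        refine le_trans (le_of_eq (lintegral_congr (fun z => ?_))) this
        simp only [hW]
        congr 3
        abel
    _ = _ := by
        rw [lintegral_const_mul _ (by
          apply Measurable.lintegral_prod_left
          exact hH)]
        congr 1
        rw [Measure.volume_eq_prod, lintegral_prod_symm _ hH.aemeasurable]

/-- Gaussian weight on space-time. -/
def gam (δ : ℝ) (p : ℝ × E3) : ℝ := Real.exp (-δ * p.1 ^ 2) * Real.exp (-δ * ‖p.2‖ ^ 2)

/-- Fourier transform of the Gaussian weight. -/
def Gam (δ : ℝ) (p : ℝ × E3) : ℝ :=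
  (Real.pi / δ) ^ 2 * (Real.exp (-(1 / (4 * δ)) * p.1 ^ 2) * Real.exp (-(1 / (4 * δ)) * ‖p.2‖ ^ 2))

lemma Gam_nonneg (δ : ℝ) (p : ℝ × E3) : 0 ≤ Gam δ p := by
  unfold Gam; positivity

lemma gam_integrable {δ : ℝ} (hδ : 0 < δ) : Integrable (gam δ) := by
  have h1 : Integrable (fun v : ℝ => Real.exp (-δ * v ^ 2)) := integrable_exp_neg_mul_sq hδ
  have h2 : Integrable (fun v : E3 => Real.exp (-δ * ‖v‖ ^ 2)) := by
    have := (GaussianFourier.integrable_cexp_neg_mul_sq_norm_add (b := (δ:ℂ)) (by simpa using hδ) 0 (0:E3)).norm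
    refine this.congr (Filter.Eventually.of_forall (fun v => ?_))
    simp only [zero_mul, add_zero, Complex.norm_exp]
    congr 1
    rw [← ofReal_pow, ← ofReal_neg, ← ofReal_mul, ofReal_re]
  exact h1.mul_prod h2

lemma rpow_half_prod {x : ℝ} (hx : 0 < x) :
    x ^ ((1:ℝ)/2) * x ^ ((3:ℝ)/2) = x ^ 2 := by
  rw [← Real.rpow_add hx]; norm_num

lemma Gam_lintegral {δ : ℝ} (hδ : 0 < δ) (z : ℝ × E3) :
    ∫⁻ p, ENNReal.ofReal (Gam δ (z - p)) = ENNReal.ofReal ((2 * Real.pi) ^ 4) := by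
  have h4 : 0 < 1 / (4 * δ) := by positivity
  have e0 : ∀ p, Gam δ (z - p) = Gam δ (p - z) := by
    intro p
    simp only [Gam, Prod.fst_sub, Prod.snd_sub]
    rw [norm_sub_rev z.2, show (z.1 - p.1) ^ 2 = (p.1 - z.1) ^ 2 by ring]
  simp_rw [e0]
  have e1 : ∫⁻ p : ℝ × E3, ENNReal.ofReal (Gam δ (p - z)) = ∫⁻ p : ℝ × E3, ENNReal.ofReal (Gam δ p) :=
    lintegral_sub_right_eq_self (μ := (volume : Measure ℝ).prod (volume : Measure E3))
      (fun p => ENNReal.ofReal (Gam δ p)) z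
  have hintg : Integrable (Gam δ) := (gam_integrable h4).const_mul _
  rw [e1, ← ofReal_integral_eq_lintegral_ofReal hintg (Filter.Eventually.of_forall (Gam_nonneg δ))]
  congr 1
  unfold Gam
  rw [integral_const_mul, Measure.volume_eq_prod,
    integral_prod_mul (fun t : ℝ => Real.exp (-(1 / (4 * δ)) * t ^ 2))
      (fun v : E3 => Real.exp (-(1 / (4 * δ)) * ‖v‖ ^ 2))]
  rw [GaussianFourier.integral_rexp_neg_mul_sq_norm h4]
  have : ∫ t : ℝ, Real.exp (-(1 / (4 * δ)) * t ^ 2) = (Real.pi / (1 / (4 * δ))) ^ ((1:ℝ)/2) := by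
    rw [integral_gaussian, Real.sqrt_eq_rpow]
  rw [this]
  simp only [finrank_euclideanSpace, Fintype.card_fin, Nat.cast_ofNat]
  rw [rpow_half_prod (by positivity)]
  field_simp
  norm_num

lemma gam_ft {δ : ℝ} (hδ : 0 < δ) (α : ℝ) (β : E3) :
    ∫ p : ℝ × E3, cexp (I * ((⟪p.2, β⟫ + p.1 * α : ℝ) : ℂ)) * (gam δ p : ℂ) = (Gam δ (α, β) : ℂ) := by
  have e : ∀ p : ℝ × E3, cexp (I * ((⟪p.2, β⟫ + p.1 * α : ℝ) : ℂ)) * (gam δ p : ℂ)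
      = cexp (-(δ:ℂ) * (‖p.1‖:ℂ) ^ 2 + I * ((inner ℝ α p.1 : ℝ) : ℂ)) *
        cexp (-(δ:ℂ) * (‖p.2‖:ℂ) ^ 2 + I * ((inner ℝ β p.2 : ℝ) : ℂ)) := by
    intro p
    unfold gam
    rw [real_inner_comm β p.2]
    push_cast
    rw [← Complex.exp_add, ← Complex.exp_add, ← Complex.exp_add]
    congr 1
    have : ((‖p.1‖ : ℝ) : ℂ) ^ 2 = (p.1 : ℂ) ^ 2 := by
      rw [← ofReal_pow, Real.norm_eq_abs, sq_abs, ofReal_pow]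
    rw [this]
    simp only [RCLike.inner_apply, conj_trivial, ofReal_mul]
    ring
  simp_rw [e]
  rw [Measure.volume_eq_prod, integral_prod_mul
    (fun t : ℝ => cexp (-(δ:ℂ) * (‖t‖:ℂ) ^ 2 + I * ((inner ℝ α t : ℝ) : ℂ)))
    (fun v : E3 => cexp (-(δ:ℂ) * (‖v‖:ℂ) ^ 2 + I * ((inner ℝ β v : ℝ) : ℂ)))]
  rw [GaussianFourier.integral_cexp_neg_mul_sq_norm_add (by simpa using hδ),
    GaussianFourier.integral_cexp_neg_mul_sq_norm_add (by simpa using hδ)]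
  unfold Gam
  simp only [finrank_euclideanSpace, Fintype.card_fin, Nat.cast_ofNat, Module.finrank_self,
    Nat.cast_one]
  have h1 : ((Real.pi : ℂ) / δ) ^ ((1:ℂ)/2) = (((Real.pi / δ) ^ ((1:ℝ)/2) : ℝ) : ℂ) := by
    rw [ofReal_cpow (by positivity)]; push_cast; rfl
  have h2 : ((Real.pi : ℂ) / δ) ^ ((3:ℂ)/2) = (((Real.pi / δ) ^ ((3:ℝ)/2) : ℝ) : ℂ) := by
    rw [ofReal_cpow (by positivity)]; push_cast; rfl
  rw [h1, h2, ← rpow_half_prod (show 0 < Real.pi / δ by positivity)]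
  have h3 : ((‖α‖ : ℝ) : ℂ) ^ 2 = (α : ℂ) ^ 2 := by
    rw [← ofReal_pow, Real.norm_eq_abs, sq_abs, ofReal_pow]
  rw [h3]
  push_cast
  have h4 : ∀ c : ℂ, I ^ 2 * c / (4 * δ) = -(1 / (4 * (δ:ℂ))) * c := by
    intro c; rw [I_sq]; ring
  rw [h4, h4]
  ring

section
variable {X : Type*} [MeasurableSpace X]

/-- The extension operator attached to a map `(Ψ0, Ψ1)`. -/
def extU (μ : Measure X) (Ψ0 : X → ℝ) (Ψ1 : X → E3) (F : X → ℂ) (p : ℝ × E3) : ℂ :=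
  ∫ ξ, cexp (I * ((⟪p.2, Ψ1 ξ⟫ + p.1 * Ψ0 ξ : ℝ) : ℂ)) * F ξ ∂μ

lemma norm_cexp_I (x : ℝ) : ‖cexp (I * (x : ℂ))‖ = 1 := by
  rw [mul_comm]; exact Complex.norm_exp_ofReal_mul_I x

lemma conj_cexp_I (x : ℝ) : (starRingEnd ℂ) (cexp (I * (x : ℂ))) = cexp (I * ((-x : ℝ) : ℂ)) := by
  rw [← Complex.exp_conj]
  congr 1
  simp

lemma extU_meas (μ : Measure X) [SFinite μ] (Ψ0 : X → ℝ) (Ψ1 : X → E3) (h0 : Measurable Ψ0)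
    (h1 : Measurable Ψ1) (F : X → ℂ) (hF : Integrable F μ) :
    Measurable (extU μ Ψ0 Ψ1 F) := by
  obtain ⟨F', hF'm, hF'⟩ := hF.1
  have : extU μ Ψ0 Ψ1 F = extU μ Ψ0 Ψ1 F' := by
    ext p
    apply integral_congr_ae
    filter_upwards [hF'] with ξ hξ
    rw [hξ]
  rw [this]
  have h3 : Measurable (fun z : (ℝ × E3) × X => (⟪z.1.2, Ψ1 z.2⟫ + z.1.1 * Ψ0 z.2 : ℝ)) := by
    apply Measurable.add
    · exact Measurable.inner (measurable_snd.comp measurable_fst) (h1.comp measurable_snd)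
    · exact (measurable_fst.comp measurable_fst).mul (h0.comp measurable_snd)
  have h4 : Measurable (fun z : (ℝ × E3) × X =>
      cexp (I * ((⟪z.1.2, Ψ1 z.2⟫ + z.1.1 * Ψ0 z.2 : ℝ) : ℂ)) * F' z.2) :=
    (Complex.measurable_exp.comp ((Complex.measurable_ofReal.comp h3).const_mul I)).mul
      (hF'm.measurable.comp measurable_snd)
  exact (h4.stronglyMeasurable.integral_prod_right').measurable

lemma gauss_identity (μ : Measure X) [SFinite μ] (Ψ0 : X → ℝ) (Ψ1 : X → E3) (h0 : Measurable Ψ0)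
    (h1 : Measurable Ψ1) (F : X → ℂ) (hF : Integrable F μ) {δ : ℝ} (hδ : 0 < δ) :
    ∫⁻ p, ‖extU μ Ψ0 Ψ1 F p‖ₑ ^ 2 * ENNReal.ofReal (gam δ p) ≤
      ∫⁻ z, ‖F z.1‖ₑ * ‖F z.2‖ₑ * ENNReal.ofReal (Gam δ (Ψ0 z.1 - Ψ0 z.2, Ψ1 z.1 - Ψ1 z.2)) ∂(μ.prod μ) := by
  set k : (ℝ × E3) → (X × X) → ℂ := fun p z =>
    (cexp (I * ((⟪p.2, Ψ1 z.1 - Ψ1 z.2⟫ + p.1 * (Ψ0 z.1 - Ψ0 z.2) : ℝ) : ℂ)) * (gam δ p : ℂ)) *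
      (F z.1 * (starRingEnd ℂ) (F z.2)) with hk
  have hkint : Integrable (Function.uncurry k) ((volume : Measure (ℝ × E3)).prod (μ.prod μ)) := by
    have hc : Integrable (fun z => (starRingEnd ℂ) (F z)) μ := by
      refine ⟨Complex.continuous_conj.comp_aestronglyMeasurable hF.1, ?_⟩
      have := hF.2
      simpa [HasFiniteIntegral] using this
    have hFF : Integrable (fun z : X × X => F z.1 * (starRingEnd ℂ) (F z.2)) (μ.prod μ) :=
      hF.mul_prod hc
    have hg : Integrable (fun p => (gam δ p : ℂ)) := (gam_integrable hδ).ofReal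
    have hall := hg.mul_prod hFF
    have := hall.bdd_mul (c := 1) (f := fun y : (ℝ × E3) × (X × X) =>
      cexp (I * ((⟪y.1.2, Ψ1 y.2.1 - Ψ1 y.2.2⟫ + y.1.1 * (Ψ0 y.2.1 - Ψ0 y.2.2) : ℝ) : ℂ))) ?_ ?_
    · refine this.congr (Filter.Eventually.of_forall (fun y => ?_))
      simp only [hk, Function.uncurry]
      ring
    · apply Measurable.aestronglyMeasurable
      have : Measurable (fun y : (ℝ × E3) × (X × X) =>
        (⟪y.1.2, Ψ1 y.2.1 - Ψ1 y.2.2⟫ + y.1.1 * (Ψ0 y.2.1 - Ψ0 y.2.2) : ℝ)) := by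
        apply Measurable.add
        · apply Measurable.inner <;> fun_prop
        · fun_prop
      fun_prop
    · exact Filter.Eventually.of_forall (fun y => (norm_cexp_I _).le)
  have hin1 : ∀ p, ∫ z, k p z ∂(μ.prod μ) = ((‖extU μ Ψ0 Ψ1 F p‖ ^ 2 * gam δ p : ℝ) : ℂ) := by
    intro p
    have : ∀ z : X × X, k p z = (gam δ p : ℂ) *
       ((cexp (I * ((⟪p.2, Ψ1 z.1⟫ + p.1 * Ψ0 z.1 : ℝ) : ℂ)) * F z.1) *
        (starRingEnd ℂ) (cexp (I * ((⟪p.2, Ψ1 z.2⟫ + p.1 * Ψ0 z.2 : ℝ) : ℂ)) * F z.2)) := by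
      intro z
      simp only [hk]
      rw [map_mul, conj_cexp_I]
      have : cexp (I * ((⟪p.2, Ψ1 z.1 - Ψ1 z.2⟫ + p.1 * (Ψ0 z.1 - Ψ0 z.2) : ℝ) : ℂ)) =
        cexp (I * ((⟪p.2, Ψ1 z.1⟫ + p.1 * Ψ0 z.1 : ℝ) : ℂ)) *
        cexp (I * ((-(⟪p.2, Ψ1 z.2⟫ + p.1 * Ψ0 z.2) : ℝ) : ℂ)) := by
        rw [← Complex.exp_add, ← mul_add, ← ofReal_add, inner_sub_right]
        congr 3; ring
      rw [this]; ring
    simp_rw [this]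
    rw [integral_const_mul, integral_prod_mul
      (fun ξ => cexp (I * ((⟪p.2, Ψ1 ξ⟫ + p.1 * Ψ0 ξ : ℝ) : ℂ)) * F ξ)
      (fun ξ => (starRingEnd ℂ) (cexp (I * ((⟪p.2, Ψ1 ξ⟫ + p.1 * Ψ0 ξ : ℝ) : ℂ)) * F ξ)),
      integral_conj]
    change _ * (extU μ Ψ0 Ψ1 F p * (starRingEnd ℂ) (extU μ Ψ0 Ψ1 F p)) = _
    rw [Complex.mul_conj, Complex.normSq_eq_norm_sq]
    push_cast; ring
  have hin2 : ∀ z : X × X, ∫ p, k p z = (F z.1 * (starRingEnd ℂ) (F z.2)) *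
      (Gam δ (Ψ0 z.1 - Ψ0 z.2, Ψ1 z.1 - Ψ1 z.2) : ℂ) := by
    intro z
    simp only [hk]
    rw [integral_mul_const, gam_ft hδ, mul_comm]
  have hswap := integral_integral_swap hkint
  simp_rw [hin1, hin2] at hswap
  have hintg : Integrable (fun p => ‖extU μ Ψ0 Ψ1 F p‖ ^ 2 * gam δ p) := by
    have := hkint.integral_prod_left
    simp only [Function.uncurry, hin1] at this
    exact this.re
  have hpos : ∀ p, 0 ≤ ‖extU μ Ψ0 Ψ1 F p‖ ^ 2 * gam δ p := by
    intro p; unfold gam; positivity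
  have hL : ∫⁻ p, ‖extU μ Ψ0 Ψ1 F p‖ₑ ^ 2 * ENNReal.ofReal (gam δ p) =
      ‖∫ p, ((‖extU μ Ψ0 Ψ1 F p‖ ^ 2 * gam δ p : ℝ) : ℂ)‖ₑ := by
    rw [integral_complex_ofReal]
    have : ‖(((∫ p, ‖extU μ Ψ0 Ψ1 F p‖ ^ 2 * gam δ p) : ℝ) : ℂ)‖ₑ =
        ENNReal.ofReal (∫ p, ‖extU μ Ψ0 Ψ1 F p‖ ^ 2 * gam δ p) := by
      rw [← ofReal_norm, Complex.norm_real, Real.norm_of_nonneg (integral_nonneg hpos)]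
    refine Eq.trans ?_ this.symm
    rw [ofReal_integral_eq_lintegral_ofReal hintg (Filter.Eventually.of_forall hpos)]
    apply lintegral_congr
    intro p
    rw [ENNReal.ofReal_mul (by positivity), ENNReal.ofReal_pow (norm_nonneg _), ofReal_norm]
  rw [hL, hswap]
  refine (enorm_integral_le_lintegral_enorm _).trans (le_of_eq ?_)
  apply lintegral_congr
  intro z
  rw [enorm_mul, enorm_mul]
  congr 1
  · congr 1
    rw [← ofReal_norm, ← ofReal_norm, RCLike.norm_conj]
  · rw [← ofReal_norm, Complex.norm_real, Real.norm_of_nonneg (Gam_nonneg _ _)]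

lemma l2_bound (μ : Measure X) [SFinite μ] (Ψ0 : X → ℝ) (Ψ1 : X → E3) (h0 : Measurable Ψ0)
    (h1 : Measurable Ψ1) (F : X → ℂ) (hF : Integrable F μ) (A : ℝ≥0∞)
    (hA : ∀ H : ℝ × E3 → ℝ≥0∞, Measurable H → ∫⁻ ξ, H (Ψ0 ξ, Ψ1 ξ) ∂μ ≤ A * ∫⁻ y, H y) :
    ∫⁻ p, ‖extU μ Ψ0 Ψ1 F p‖ₑ ^ 2 ≤ ENNReal.ofReal ((2 * Real.pi) ^ 4) * A * ∫⁻ ξ, ‖F ξ‖ₑ ^ 2 ∂μ := by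
  set M := ENNReal.ofReal ((2 * Real.pi) ^ 4) * A * ∫⁻ ξ, ‖F ξ‖ₑ ^ 2 ∂μ with hM
  have hgm : ∀ δ, Measurable (gam δ) := by intro δ; unfold gam; fun_prop
  have hGm : ∀ δ, Measurable (Gam δ) := by intro δ; unfold Gam; fun_prop
  have step : ∀ δ : ℝ, 0 < δ →
      ∫⁻ p, ‖extU μ Ψ0 Ψ1 F p‖ₑ ^ 2 * ENNReal.ofReal (gam δ p) ≤ M := by
    intro δ hδ
    refine (gauss_identity μ Ψ0 Ψ1 h0 h1 F hF hδ).trans ?_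
    set Kf : X × X → ℝ≥0∞ := fun z => ENNReal.ofReal (Gam δ (Ψ0 z.1 - Ψ0 z.2, Ψ1 z.1 - Ψ1 z.2)) with hK
    have hKm : Measurable Kf := by
      apply ENNReal.measurable_ofReal.comp
      apply (hGm δ).comp
      fun_prop
    have hKs : ∀ z : X × X, Kf z.swap = Kf z := by
      intro z
      simp only [hK, Gam, Prod.fst_swap, Prod.snd_swap]
      rw [norm_sub_rev (Ψ1 z.2), show (Ψ0 z.2 - Ψ0 z.1) ^ 2 = (Ψ0 z.1 - Ψ0 z.2) ^ 2 by ring]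
    have hFm : AEMeasurable (fun ξ => ‖F ξ‖ₑ ^ 2) μ := hF.1.enorm.pow_const 2
    have hone : ∫⁻ z, ‖F z.1‖ₑ ^ 2 * Kf z ∂(μ.prod μ) ≤ M := by
      refine (lintegral_prod_le _).trans ?_
      calc ∫⁻ ξ, ∫⁻ ξ', ‖F ξ‖ₑ ^ 2 * Kf (ξ, ξ') ∂μ ∂μ
          ≤ ∫⁻ ξ, ‖F ξ‖ₑ ^ 2 * (A * ENNReal.ofReal ((2 * Real.pi) ^ 4)) ∂μ := by
            apply lintegral_mono
            intro ξ
            simp only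
            rw [lintegral_const_mul' _ _ (by simp)]
            gcongr
            have := hA (fun y => ENNReal.ofReal (Gam δ ((Ψ0 ξ, Ψ1 ξ) - y)))
              (ENNReal.measurable_ofReal.comp ((hGm δ).comp (by fun_prop)))
            rw [Gam_lintegral hδ] at this
            exact this
        _ = M := by
            rw [lintegral_mul_const'' _ hFm, hM]; ring
    have htwo : ∫⁻ z, ‖F z.2‖ₑ ^ 2 * Kf z ∂(μ.prod μ) ≤ M := by
      rw [← lintegral_prod_swap]
      refine le_trans (le_of_eq (lintegral_congr (fun z => ?_))) hone
      rw [hKs]; rfl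
    have hAM : ∀ a b : ℝ≥0∞, a * b ≤ 2⁻¹ * (a ^ 2) + 2⁻¹ * b ^ 2 := by
      intro a b
      have := ENNReal.young_inequality a b Real.HolderConjugate.two_two
      simpa [div_eq_mul_inv, mul_comm] using this
    calc ∫⁻ z, ‖F z.1‖ₑ * ‖F z.2‖ₑ * Kf z ∂(μ.prod μ)
        ≤ ∫⁻ z, (2⁻¹ * (‖F z.1‖ₑ ^ 2 * Kf z) + 2⁻¹ * (‖F z.2‖ₑ ^ 2 * Kf z)) ∂(μ.prod μ) := by
          apply lintegral_mono
          intro z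
          calc ‖F z.1‖ₑ * ‖F z.2‖ₑ * Kf z ≤ (2⁻¹ * (‖F z.1‖ₑ ^ 2) + 2⁻¹ * ‖F z.2‖ₑ ^ 2) * Kf z := by
                gcongr; exact hAM _ _
            _ = _ := by ring
      _ = 2⁻¹ * ∫⁻ z, (‖F z.1‖ₑ ^ 2 * Kf z) ∂(μ.prod μ) + 2⁻¹ * ∫⁻ z, (‖F z.2‖ₑ ^ 2 * Kf z) ∂(μ.prod μ) := by
          have hm1 : AEMeasurable (fun z : X × X => ‖F z.1‖ₑ ^ 2 * Kf z) (μ.prod μ) :=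
            (hFm.comp_fst).mul hKm.aemeasurable
          rw [lintegral_add_left' (hm1.const_mul _), lintegral_const_mul' _ _ (by simp),
            lintegral_const_mul' _ _ (by simp)]
      _ ≤ 2⁻¹ * M + 2⁻¹ * M := by gcongr
      _ = M := by rw [← add_mul, ENNReal.inv_two_add_inv_two, one_mul]
  have hlim : ∀ p, Filter.liminf (fun n : ℕ => ‖extU μ Ψ0 Ψ1 F p‖ₑ ^ 2 *
      ENNReal.ofReal (gam (1 / ((n:ℝ) + 1)) p)) Filter.atTop = ‖extU μ Ψ0 Ψ1 F p‖ₑ ^ 2 := by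
    intro p
    apply Filter.Tendsto.liminf_eq
    have : Filter.Tendsto (fun n : ℕ => gam (1 / ((n:ℝ) + 1)) p) Filter.atTop (nhds (gam 0 p)) := by
      have hc : Continuous (fun δ => gam δ p) := by unfold gam; fun_prop
      exact (hc.tendsto 0).comp tendsto_one_div_add_atTop_nhds_zero_nat
    have h1 : gam 0 p = 1 := by simp [gam]
    rw [h1] at this
    have h2 := ENNReal.tendsto_ofReal this
    have h3 := ENNReal.Tendsto.const_mul (a := ‖extU μ Ψ0 Ψ1 F p‖ₑ ^ 2) h2 (Or.inl (by simp))
    simpa using h3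
  calc ∫⁻ p, ‖extU μ Ψ0 Ψ1 F p‖ₑ ^ 2
      = ∫⁻ p, Filter.liminf (fun n : ℕ => ‖extU μ Ψ0 Ψ1 F p‖ₑ ^ 2 *
      ENNReal.ofReal (gam (1 / ((n:ℝ) + 1)) p)) Filter.atTop := by simp_rw [hlim]
    _ ≤ Filter.liminf (fun n : ℕ => ∫⁻ p, ‖extU μ Ψ0 Ψ1 F p‖ₑ ^ 2 *
      ENNReal.ofReal (gam (1 / ((n:ℝ) + 1)) p)) Filter.atTop := by
        apply lintegral_liminf_le
        intro n
        exact ((extU_meas μ Ψ0 Ψ1 h0 h1 F hF).enorm.pow_const 2).mul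
          (ENNReal.measurable_ofReal.comp (hgm _))
    _ ≤ M := by
        apply Filter.liminf_le_of_le
        · isBoundedDefault
        · intro b hb
          obtain ⟨n, hn⟩ := hb.exists
          exact hn.trans (step _ (by positivity))
end

lemma minkowski_sq {X ι : Type*} [MeasurableSpace X] [Countable ι] (μ : Measure X)
    (f : ι → X → ℝ≥0∞) (hf : ∀ i, Measurable (f i)) :
    ∫⁻ x, (∑' i, f i x) ^ 2 ∂μ ≤ (∑' i, (∫⁻ x, f i x ^ 2 ∂μ) ^ (1 / 2 : ℝ)) ^ 2 := by
  have e1 : ∀ x, (∑' i, f i x) ^ 2 = ∑' i, ∑' j, f i x * f j x := by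
    intro x
    rw [sq, ← ENNReal.tsum_mul_right]
    congr 1; ext i
    rw [ENNReal.tsum_mul_left]
  have e2 : (∑' i, (∫⁻ x, f i x ^ 2 ∂μ) ^ (1 / 2 : ℝ)) ^ 2 =
      ∑' i, ∑' j, (∫⁻ x, f i x ^ 2 ∂μ) ^ (1 / 2 : ℝ) * (∫⁻ x, f j x ^ 2 ∂μ) ^ (1 / 2 : ℝ) := by
    rw [sq, ← ENNReal.tsum_mul_right]
    congr 1; ext i
    rw [ENNReal.tsum_mul_left]
  simp_rw [e1]
  rw [e2, lintegral_tsum]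
  · gcongr with i
    rw [lintegral_tsum]
    · gcongr with j
      have := ENNReal.lintegral_mul_le_Lp_mul_Lq μ Real.HolderConjugate.two_two
        (hf i).aemeasurable (hf j).aemeasurable
      simpa using this
    · intro j; exact ((hf i).mul (hf j)).aemeasurable
  · intro i
    exact (Measurable.ennreal_tsum (fun j => (hf i).mul (hf j))).aemeasurable

/-- off-diagonal decay weights -/
def cw (k : ℤ) : ℝ≥0∞ := ENNReal.ofReal ((2:ℝ) ^ (-(|(k:ℝ)|) / 4))

/-- sum of the weights -/
def Cs : ℝ≥0∞ := ∑' k : ℤ, cw k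

lemma Cs_ne_top : Cs ≠ ⊤ := by
  have hs : Summable (fun k : ℤ => (2:ℝ) ^ (-(|(k:ℝ)|) / 4)) := by
    have hg : Summable (fun n : ℕ => (2:ℝ) ^ (-(n:ℝ) / 4)) := by
      have : (fun n : ℕ => (2:ℝ) ^ (-(n:ℝ) / 4)) = fun n : ℕ => ((2:ℝ) ^ (-(1:ℝ)/4)) ^ n := by
        ext n
        rw [← Real.rpow_natCast, ← Real.rpow_mul (by norm_num)]
        congr 1; ring
      rw [this]
      apply summable_geometric_of_lt_one (by positivity)
      apply Real.rpow_lt_one_of_one_lt_of_neg (by norm_num) (by norm_num)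
    apply Summable.of_nat_of_neg
    · simpa using hg
    · simpa using hg
  unfold Cs cw
  rw [← ENNReal.ofReal_tsum_of_nonneg (fun _ => by positivity) hs]
  exact ENNReal.ofReal_ne_top

lemma amgm (a b : ℝ≥0∞) : a * b ≤ 2⁻¹ * (a ^ 2) + 2⁻¹ * b ^ 2 := by
  have := ENNReal.young_inequality a b Real.HolderConjugate.two_two
  simpa [div_eq_mul_inv, mul_comm] using this

lemma cw_sum (k : ℤ) : ∑' l : ℤ, cw (k - l) = Cs :=
  (Equiv.subLeft k).tsum_eq cw

lemma cw_sum' (k : ℤ) : ∑' l : ℤ, cw (l - k) = Cs :=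
  (Equiv.subRight k).tsum_eq cw

lemma triple_sum (H : ℤ → ℝ≥0∞) :
    ∑' k : ℤ × ℤ × ℤ, cw (k.1 - k.2.1) * cw (k.1 - k.2.2) * (H k.1 * H k.2.1 * H k.2.2) ≤
      Cs ^ 2 * ((∑' k, H k ^ 2) ^ (1 / 2 : ℝ)) ^ 3 := by
  set S := ∑' k, H k ^ 2 with hS
  set Hs := S ^ (1 / 2 : ℝ) with hHs
  have hsq : Hs ^ 2 = S := by
    rw [hHs, ← ENNReal.rpow_natCast, ← ENNReal.rpow_mul]; norm_num
  have hle : ∀ k, H k ≤ Hs := by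
    intro k
    have : H k ^ 2 ≤ Hs ^ 2 := by rw [hsq]; exact ENNReal.le_tsum k
    exact (ENNReal.pow_le_pow_left_iff two_ne_zero).1 this
  rw [ENNReal.tsum_prod']
  calc ∑' a : ℤ, ∑' b : ℤ × ℤ, cw (a - b.1) * cw (a - b.2) * (H a * H b.1 * H b.2)
      ≤ ∑' a : ℤ, ∑' b : ℤ × ℤ, (cw (a - b.1) * (H a * H b.1) * Hs) * cw (a - b.2) := by
        refine ENNReal.tsum_le_tsum fun a => ENNReal.tsum_le_tsum fun b => ?_
        calc cw (a - b.1) * cw (a - b.2) * (H a * H b.1 * H b.2)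
            ≤ cw (a - b.1) * cw (a - b.2) * (H a * H b.1 * Hs) := by gcongr; exact hle _
          _ = _ := by ring
    _ = ∑' a : ℤ, ∑' b : ℤ, (cw (a - b) * (H a * H b)) * (Hs * Cs) := by
        congr 1; ext a
        rw [ENNReal.tsum_prod']
        congr 1; ext b
        simp only
        rw [ENNReal.tsum_mul_left, cw_sum]; ring
    _ = (∑' a : ℤ, ∑' b : ℤ, cw (a - b) * (H a * H b)) * (Hs * Cs) := by
        simp_rw [ENNReal.tsum_mul_right]
    _ ≤ (∑' a : ℤ, ∑' b : ℤ, (2⁻¹ * (H a ^ 2 * cw (a - b)) + 2⁻¹ * (H b ^ 2 * cw (a - b)))) * (Hs * Cs) := by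
        gcongr ?_ * _
        refine ENNReal.tsum_le_tsum fun a => ENNReal.tsum_le_tsum fun b => ?_
        calc cw (a - b) * (H a * H b) ≤ cw (a - b) * (2⁻¹ * H a ^ 2 + 2⁻¹ * H b ^ 2) := by
              gcongr; exact amgm _ _
          _ = _ := by ring
    _ = (2⁻¹ * (S * Cs) + 2⁻¹ * (S * Cs)) * (Hs * Cs) := by
        congr 1
        simp_rw [ENNReal.tsum_add, ENNReal.tsum_mul_left]
        congr 2
        · simp_rw [cw_sum]; rw [ENNReal.tsum_mul_right]
        · rw [ENNReal.tsum_comm]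
          simp_rw [ENNReal.tsum_mul_left, cw_sum']; rw [ENNReal.tsum_mul_right]
    _ = _ := by
        rw [← add_mul, ENNReal.inv_two_add_inv_two, one_mul, ← hsq]; ring

/-- extension operator over a set of frequencies -/
def uS (q : E3 → ℝ) (S : Set E3) (f : E3 → ℂ) (p : ℝ × E3) : ℂ :=
  extU (volume.restrict S) q id f p

lemma trilinear {m N1 N2 R : ℝ} (hm : 0 < m) (hN1 : 0 < N1) (hN2 : 0 < N2) (hR : 0 < R)
    (q q1 q2 : E3 → ℝ) (hqm : Measurable q) (e : E3) (he : ‖e‖ ≤ R) (Q1 Q2 Q3 : Set E3)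
    (hc1 : IsClosed Q1) (hc2 : IsClosed Q2) (hc3 : IsClosed Q3)
    (hv1 : Convex ℝ Q1) (hv2 : Convex ℝ Q2) (hv3 : Convex ℝ Q3)
    (hq1 : ContinuousOn q Q1) (hq2 : ContinuousOn q Q2) (hq3 : ContinuousOn q Q3)
    (hd1 : ConvexAlong q q1 q2 e Q1 (m / N1 ^ 2)) (hd2 : ConvexAlong q q1 q2 e Q2 (m / N2 ^ 2))
    (hd3 : ConvexAlong q q1 q2 e Q3 0)
    (hb1 : ∀ ξ ∈ Q1, ‖ξ‖ ≤ R * N1) (hb2 : ∀ ξ ∈ Q2, ‖ξ‖ ≤ R * N2)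
    (S1 S2 S3 : Set E3) (hs1 : S1 ⊆ Q1) (hs2 : S2 ⊆ Q2) (hs3 : S3 ⊆ Q3)
    (f : E3 → ℂ) (hf : Integrable f) :
    ∫⁻ p, (‖uS q S1 f p‖ₑ * ‖uS q S2 f p‖ₑ * ‖uS q S3 f p‖ₑ) ^ 2 ≤
      ENNReal.ofReal ((2 * Real.pi) ^ 4) *
        (ENNReal.ofReal ((2 * R) ^ 6 * (2 * Real.pi) * (N1 ^ 3 * N2 ^ 3 / m)) * vB ^ 2) *
        ((∫⁻ ξ in S1, ‖f ξ‖ₑ ^ 2) * (∫⁻ ξ in S2, ‖f ξ‖ₑ ^ 2) * (∫⁻ ξ in S3, ‖f ξ‖ₑ ^ 2)) := by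
  set μ := (volume.restrict S1).prod ((volume.restrict S2).prod (volume.restrict S3)) with hμ
  have hle : μ ≤ ((volume.restrict Q1).prod ((volume.restrict Q2).prod (volume.restrict Q3))) := by
    rw [hμ, Measure.prod_restrict, Measure.prod_restrict, Measure.prod_restrict, Measure.prod_restrict]
    exact Measure.restrict_mono (Set.prod_mono hs1 (Set.prod_mono hs2 hs3)) le_rfl
  have hintg : Integrable (fun z : E3 × E3 × E3 => f z.1 * (f z.2.1 * f z.2.2)) μ :=
    (hf.restrict).mul_prod ((hf.restrict).mul_prod (hf.restrict))
  have key := l2_bound μ (fun z => q z.1 + q z.2.1 + q z.2.2) (fun z => z.1 + z.2.1 + z.2.2)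
    (by fun_prop) (by fun_prop) (fun z => f z.1 * (f z.2.1 * f z.2.2)) hintg _
    (fun H hH => (lintegral_mono' hle le_rfl).trans
      (push_bound hm hN1 hN2 hR q q1 q2 hqm e he Q1 Q2 Q3 hc1 hc2 hc3 hv1 hv2 hv3 hq1 hq2 hq3
        hd1 hd2 hd3 hb1 hb2 H hH))
  have e1 : ∀ p, extU μ (fun z => q z.1 + q z.2.1 + q z.2.2) (fun z => z.1 + z.2.1 + z.2.2)
      (fun z => f z.1 * (f z.2.1 * f z.2.2)) p = uS q S1 f p * (uS q S2 f p * uS q S3 f p) := by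
    intro p
    unfold uS extU
    rw [← integral_prod_mul, ← integral_prod_mul]
    apply integral_congr_ae
    refine Filter.Eventually.of_forall (fun z => ?_)
    simp only [id]
    rw [inner_add_right, inner_add_right]
    have : cexp (I * ((⟪p.2, z.1⟫ + ⟪p.2, z.2.1⟫ + ⟪p.2, z.2.2⟫ + p.1 * (q z.1 + q z.2.1 + q z.2.2) : ℝ) : ℂ))
      = cexp (I * ((⟪p.2, z.1⟫ + p.1 * q z.1 : ℝ) : ℂ)) * (cexp (I * ((⟪p.2, z.2.1⟫ + p.1 * q z.2.1 : ℝ) : ℂ))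
        * cexp (I * ((⟪p.2, z.2.2⟫ + p.1 * q z.2.2 : ℝ) : ℂ))) := by
      rw [← Complex.exp_add, ← Complex.exp_add]
      congr 1
      push_cast; ring
    rw [this]; ring
  have e2 : ∫⁻ ξ, ‖f ξ.1 * (f ξ.2.1 * f ξ.2.2)‖ₑ ^ 2 ∂μ =
      ((∫⁻ ξ in S1, ‖f ξ‖ₑ ^ 2) * (∫⁻ ξ in S2, ‖f ξ‖ₑ ^ 2) * (∫⁻ ξ in S3, ‖f ξ‖ₑ ^ 2)) := by
    have hm : ∀ S : Set E3, AEMeasurable (fun ξ => ‖f ξ‖ₑ ^ 2) (volume.restrict S) :=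
      fun S => (hf.1.restrict).enorm.pow_const 2
    simp_rw [enorm_mul, mul_pow]
    rw [hμ, lintegral_prod_mul (hm S1)
      (g := fun z : E3 × E3 => ‖f z.1‖ₑ ^ 2 * ‖f z.2‖ₑ ^ 2) ((hm S2).comp_fst.mul (hm S3).comp_snd),
      lintegral_prod_mul (hm S2) (hm S3), mul_assoc]
  rw [e2] at key
  refine le_trans (le_of_eq (lintegral_congr (fun p => ?_))) key
  rw [e1, enorm_mul, enorm_mul, mul_assoc]

/-- dyadic slice of a cone, closed version -/
def slQ (K : Set E3) (i : Fin 3) (k : ℤ) : Set E3 := {ξ | ξ ∈ K ∧ (2:ℝ) ^ k ≤ ξ i ∧ ξ i ≤ 2 * (2:ℝ) ^ k}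

/-- dyadic slice of a cone, half-open version -/
def slS (K : Set E3) (i : Fin 3) (k : ℤ) : Set E3 := {ξ | ξ ∈ K ∧ (2:ℝ) ^ k ≤ ξ i ∧ ξ i < (2:ℝ) ^ (k + 1)}

lemma slS_sub (K : Set E3) (i : Fin 3) (k : ℤ) : slS K i k ⊆ slQ K i k := by
  rintro ξ ⟨h1, h2, h3⟩
  refine ⟨h1, h2, ?_⟩
  rw [zpow_add_one₀ (by norm_num)] at h3
  linarith

lemma cont_coord (i : Fin 3) : Continuous (fun ξ : E3 => ξ i) := by fun_prop

lemma slQ_closed {K : Set E3} (hK : IsClosed K) (i : Fin 3) (k : ℤ) : IsClosed (slQ K i k) := by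
  have h1 : IsClosed {ξ : E3 | (2:ℝ) ^ k ≤ ξ i} := isClosed_le continuous_const (cont_coord i)
  have h2 : IsClosed {ξ : E3 | ξ i ≤ 2 * (2:ℝ) ^ k} := isClosed_le (cont_coord i) continuous_const
  exact hK.inter (h1.inter h2)

lemma slQ_convex {K : Set E3} (hK : Convex ℝ K) (i : Fin 3) (k : ℤ) : Convex ℝ (slQ K i k) := by
  have hl : IsLinearMap ℝ (fun ξ : E3 => ξ i) := ⟨fun _ _ => rfl, fun _ _ => rfl⟩
  exact hK.inter ((convex_halfSpace_ge hl _).inter (convex_halfSpace_le hl _))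

lemma slS_meas {K : Set E3} (hK : IsClosed K) (i : Fin 3) (k : ℤ) : MeasurableSet (slS K i k) := by
  have h1 : MeasurableSet {ξ : E3 | (2:ℝ) ^ k ≤ ξ i} :=
    measurableSet_le measurable_const (cont_coord i).measurable
  have h2 : MeasurableSet {ξ : E3 | ξ i < (2:ℝ) ^ (k+1)} :=
    measurableSet_lt (cont_coord i).measurable measurable_const
  exact hK.measurableSet.inter (h1.inter h2)

lemma slS_disj (K : Set E3) (i : Fin 3) : Pairwise (Function.onFun Disjoint (slS K i)) := by
  intro k l hkl
  have key : ∀ k l : ℤ, k < l → Disjoint (slS K i k) (slS K i l) := by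
    intro k l h
    rw [Set.disjoint_left]
    rintro ξ ⟨_, _, h3⟩ ⟨_, h4, _⟩
    have : (2:ℝ) ^ (k+1) ≤ (2:ℝ) ^ l := zpow_le_zpow_right₀ (by norm_num) (by omega)
    linarith
  rcases lt_or_gt_of_ne hkl with h | h
  · exact key k l h
  · exact (key l k h).symm

lemma slS_cover (K : Set E3) (i : Fin 3) {ξ : E3} (h : ξ ∈ K) (h0 : 0 < ξ i) : ξ ∈ ⋃ k, slS K i k := by
  obtain ⟨n, hn⟩ := exists_mem_Ico_zpow h0 (by norm_num : (1:ℝ) < 2)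
  exact Set.mem_iUnion.2 ⟨n, h, hn.1, hn.2⟩

/-- hypotheses for a good cone -/
structure GoodCone (m R : ℝ) (i : Fin 3) (q q1 q2 : E3 → ℝ) (e : E3) (K : Set E3) : Prop where
  hm : 0 < m
  hR : 0 < R
  hqm : Measurable q
  he : ‖e‖ ≤ R
  closed : IsClosed K
  convex : Convex ℝ K
  bound : ∀ ξ ∈ K, ‖ξ‖ ≤ R * ξ i
  cont : ∀ ξ ∈ K, 0 < ξ i → ContinuousAt q ξ
  d1 : ∀ ξ ∈ K, 0 < ξ i → HasDerivAt (fun s : ℝ => q (ξ + s • e)) (q1 ξ) 0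
  d2 : ∀ ξ ∈ K, 0 < ξ i → HasDerivAt (fun s : ℝ => q1 (ξ + s • e)) (q2 ξ) 0
  low : ∀ ξ ∈ K, 0 < ξ i → m / (ξ i) ^ 2 ≤ q2 ξ

/-- the constant in the trilinear estimates -/
def Bc (m R : ℝ) : ℝ≥0∞ := ENNReal.ofReal ((2 * Real.pi) ^ 4) *
   (ENNReal.ofReal ((2 * (2 * R)) ^ 6 * (2 * Real.pi) * 4 / m) * vB ^ 2)

lemma cone_tri {m R : ℝ} {i : Fin 3} {q q1 q2 : E3 → ℝ} {e : E3} {K : Set E3}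
    (G : GoodCone m R i q q1 q2 e K) (f : E3 → ℂ) (hf : Integrable f) (k1 k2 k3 : ℤ) :
    ∫⁻ p, (‖uS q (slS K i k1) f p‖ₑ * ‖uS q (slS K i k2) f p‖ₑ * ‖uS q (slS K i k3) f p‖ₑ) ^ 2 ≤
      Bc m R * ENNReal.ofReal ((2:ℝ) ^ (((k1 + k2 - 2 * k3 : ℤ)) : ℝ)) *
        ((ENNReal.ofReal ((2:ℝ) ^ k1) ^ 2 * ∫⁻ ξ in slS K i k1, ‖f ξ‖ₑ ^ 2) *
         (ENNReal.ofReal ((2:ℝ) ^ k2) ^ 2 * ∫⁻ ξ in slS K i k2, ‖f ξ‖ₑ ^ 2) *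
         (ENNReal.ofReal ((2:ℝ) ^ k3) ^ 2 * ∫⁻ ξ in slS K i k3, ‖f ξ‖ₑ ^ 2)) := by
  have hm := G.hm
  have hR := G.hR
  have pos : ∀ k : ℤ, (0:ℝ) < 2 ^ k := fun k => by positivity
  have hpos : ∀ k, ∀ ξ ∈ slQ K i k, 0 < ξ i := fun k ξ h => (pos k).trans_le h.2.1
  have hca : ∀ k, ConvexAlong q q1 q2 e (slQ K i k) (m / 4 / ((2:ℝ) ^ k) ^ 2) := by
    intro k ξ h
    refine ⟨G.d1 ξ h.1 (hpos k ξ h), G.d2 ξ h.1 (hpos k ξ h), le_trans ?_ (G.low ξ h.1 (hpos k ξ h))⟩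
    rw [div_div]
    apply div_le_div_of_nonneg_left hm.le (by have := hpos k ξ h; positivity)
    have := h.2.2
    have := hpos k ξ h
    nlinarith
  have hcont : ∀ k, ContinuousOn q (slQ K i k) := fun k ξ h =>
    (G.cont ξ h.1 (hpos k ξ h)).continuousWithinAt
  have hb : ∀ k, ∀ ξ ∈ slQ K i k, ‖ξ‖ ≤ 2 * R * (2:ℝ) ^ k := by
    intro k ξ h
    have h1 := G.bound ξ h.1
    have h2 := h.2.2
    have : R * ξ i ≤ R * (2 * (2:ℝ) ^ k) := by gcongr
    linarith
  have T := trilinear (m := m / 4) (N1 := 2 ^ k1) (N2 := 2 ^ k2) (R := 2 * R) (by positivity) (pos _) (pos _)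
    (by positivity) q q1 q2 G.hqm e (G.he.trans (by linarith)) (slQ K i k1) (slQ K i k2) (slQ K i k3)
    (slQ_closed G.closed _ _) (slQ_closed G.closed _ _) (slQ_closed G.closed _ _)
    (slQ_convex G.convex _ _) (slQ_convex G.convex _ _) (slQ_convex G.convex _ _)
    (hcont _) (hcont _) (hcont _) (hca _) (hca _)
    (fun ξ h => ⟨(hca k3 ξ h).1, (hca k3 ξ h).2.1, le_trans (by positivity) (hca k3 ξ h).2.2⟩)
    (hb _) (hb _) _ _ _ (slS_sub K i k1) (slS_sub K i k2) (slS_sub K i k3) f hf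
  refine T.trans (le_of_eq ?_)
  set a1 := ∫⁻ ξ in slS K i k1, ‖f ξ‖ₑ ^ 2
  set a2 := ∫⁻ ξ in slS K i k2, ‖f ξ‖ₑ ^ 2
  set a3 := ∫⁻ ξ in slS K i k3, ‖f ξ‖ₑ ^ 2
  have e1 : ENNReal.ofReal ((2 * (2 * R)) ^ 6 * (2 * Real.pi) * (((2:ℝ) ^ k1) ^ 3 * ((2:ℝ) ^ k2) ^ 3 / (m / 4))) =
     ENNReal.ofReal ((2 * (2 * R)) ^ 6 * (2 * Real.pi) * 4 / m) * (ENNReal.ofReal ((2:ℝ) ^ (((k1 + k2 - 2 * k3 : ℤ)) : ℝ)) *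
       (ENNReal.ofReal ((2:ℝ) ^ k1) ^ 2 * ENNReal.ofReal ((2:ℝ) ^ k2) ^ 2 * ENNReal.ofReal ((2:ℝ) ^ k3) ^ 2)) := by
    have hz : (2:ℝ) ^ (k1 + k2 - 2 * k3 : ℤ) = 2 ^ k1 * 2 ^ k2 / (2 ^ k3) ^ 2 := by
      rw [zpow_sub₀ (by norm_num), zpow_add₀ (by norm_num), mul_comm 2 k3, zpow_mul]
      norm_cast
    rw [Real.rpow_intCast, ← ENNReal.ofReal_pow (by positivity), ← ENNReal.ofReal_pow (by positivity), ← ENNReal.ofReal_pow (by positivity),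
      ← ENNReal.ofReal_mul (by positivity), ← ENNReal.ofReal_mul (by positivity),
      ← ENNReal.ofReal_mul (by positivity), ← ENNReal.ofReal_mul (by positivity), hz]
    congr 1
    have := (pos k3).ne'
    field_simp
  rw [e1, Bc]
  ring

/-- weighted slice mass -/
def Hk (K : Set E3) (i : Fin 3) (f : E3 → ℂ) (k : ℤ) : ℝ≥0∞ :=
  (ENNReal.ofReal ((2:ℝ) ^ k) ^ 2 * ∫⁻ ξ in slS K i k, ‖f ξ‖ₑ ^ 2) ^ (1 / 2 : ℝ)

lemma half_sq (x : ℝ≥0∞) : (x ^ (1 / 2 : ℝ)) ^ 2 = x := by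
  rw [← ENNReal.rpow_natCast, ← ENNReal.rpow_mul]; norm_num

lemma cone_tri2 {m R : ℝ} {i : Fin 3} {q q1 q2 : E3 → ℝ} {e : E3} {K : Set E3}
    (G : GoodCone m R i q q1 q2 e K) (f : E3 → ℂ) (hf : Integrable f) (k1 k2 k3 : ℤ) :
    ∫⁻ p, (‖uS q (slS K i k1) f p‖ₑ * ‖uS q (slS K i k2) f p‖ₑ * ‖uS q (slS K i k3) f p‖ₑ) ^ 2 ≤
      Bc m R * (cw (k1 - k2) * cw (k1 - k3) * (Hk K i f k1 * Hk K i f k2 * Hk K i f k3)) ^ 2 := by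
  have hw : (cw (k1 - k2) * cw (k1 - k3)) ^ 2 =
      ENNReal.ofReal ((2:ℝ) ^ (-(|((k1 - k2 : ℤ) : ℝ)| + |((k1 - k3 : ℤ) : ℝ)|) / 2)) := by
    unfold cw
    rw [← ENNReal.ofReal_mul (by positivity), ← ENNReal.ofReal_pow (by positivity),
      ← Real.rpow_add (by norm_num), ← Real.rpow_natCast, ← Real.rpow_mul (by norm_num)]
    congr 2
    push_cast; ring
  have hH : ∀ k, Hk K i f k ^ 2 = ENNReal.ofReal ((2:ℝ) ^ k) ^ 2 * ∫⁻ ξ in slS K i k, ‖f ξ‖ₑ ^ 2 :=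
    fun k => half_sq _
  have hx : ∀ n : ℤ, 2 * n ≤ -(|k1 - k2| + |k1 - k3|) → ENNReal.ofReal ((2:ℝ) ^ (n : ℝ)) ≤
     (cw (k1 - k2) * cw (k1 - k3)) ^ 2 := by
    intro n hn
    rw [hw]
    apply ENNReal.ofReal_le_ofReal
    apply Real.rpow_le_rpow_of_exponent_le (by norm_num)
    have : (2 * n : ℝ) ≤ -(|((k1 - k2 : ℤ) : ℝ)| + |((k1 - k3 : ℤ) : ℝ)|) := by exact_mod_cast hn
    linarith
  have hr : Bc m R * (cw (k1 - k2) * cw (k1 - k3) * (Hk K i f k1 * Hk K i f k2 * Hk K i f k3)) ^ 2 =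
      Bc m R * (cw (k1 - k2) * cw (k1 - k3)) ^ 2 *
        (Hk K i f k1 ^ 2 * Hk K i f k2 ^ 2 * Hk K i f k3 ^ 2) := by ring
  rw [hr, hH, hH, hH]
  rcases le_total k1 k2 with h12 | h12 <;> rcases le_total k1 k3 with h13 | h13 <;>
    rcases le_total k2 k3 with h23 | h23
  all_goals first
    | (refine (cone_tri G f hf k1 k2 k3).trans ?_
       gcongr
       apply hx
       simp only [abs_le, abs_of_nonneg, abs_of_nonpos, sub_nonneg, sub_nonpos, h12, h13]
       omega)
    | (have T := cone_tri G f hf k1 k3 k2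
       refine le_trans (le_of_eq ?_) (T.trans (b := _) (c := _) ?_)
       · congr 1; ext p; ring
       · refine le_trans (mul_le_mul_left (mul_le_mul_right (hx _ ?_) _) _) (le_of_eq ?_)
         · simp only [abs_of_nonneg, abs_of_nonpos, sub_nonneg, sub_nonpos, h12, h13]
           omega
         · ring)
    | (have T := cone_tri G f hf k2 k3 k1
       refine le_trans (le_of_eq ?_) (T.trans (b := _) (c := _) ?_)
       · congr 1; ext p; ring
       · refine le_trans (mul_le_mul_left (mul_le_mul_right (hx _ ?_) _) _) (le_of_eq ?_)
         · simp only [abs_of_nonneg, abs_of_nonpos, sub_nonneg, sub_nonpos, h12, h13]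
           omega
         · ring)

lemma sum_Hk (K : Set E3) (hK : IsClosed K) (i : Fin 3) (f : E3 → ℂ) :
    ∑' k, Hk K i f k ^ 2 ≤ ∫⁻ ξ, ‖ξ‖ₑ ^ 2 * ‖f ξ‖ₑ ^ 2 := by
  have h1 : ∀ k, Hk K i f k ^ 2 ≤ ∫⁻ ξ in slS K i k, ‖ξ‖ₑ ^ 2 * ‖f ξ‖ₑ ^ 2 := by
    intro k
    unfold Hk
    rw [half_sq, ← lintegral_const_mul' _ _ (by finiteness)]
    apply setLIntegral_mono' (slS_meas hK i k)
    intro ξ hξ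
    gcongr
    rw [← ofReal_norm]
    apply ENNReal.ofReal_le_ofReal
    refine hξ.2.1.trans ((le_abs_self _).trans ?_)
    exact PiLp.norm_apply_le ξ i
  calc _ ≤ ∑' k, ∫⁻ ξ in slS K i k, ‖ξ‖ₑ ^ 2 * ‖f ξ‖ₑ ^ 2 := ENNReal.tsum_le_tsum h1
    _ = ∫⁻ ξ in ⋃ k, slS K i k, ‖ξ‖ₑ ^ 2 * ‖f ξ‖ₑ ^ 2 :=
        (lintegral_iUnion (fun k => slS_meas hK i k) (slS_disj K i) _).symm
    _ ≤ _ := setLIntegral_le_lintegral _ _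

lemma cone_decomp {m R : ℝ} {i : Fin 3} {q q1 q2 : E3 → ℝ} {e : E3} {K : Set E3}
    (G : GoodCone m R i q q1 q2 e K) (f : E3 → ℂ) (hf : Integrable f) (hfK : ∀ ξ, ξ ∉ K → f ξ = 0)
    (p : ℝ × E3) : ‖extU volume q id f p‖ₑ ≤ ∑' k, ‖uS q (slS K i k) f p‖ₑ := by
  set g : E3 → ℂ := fun ξ => cexp (I * ((⟪p.2, id ξ⟫ + p.1 * q ξ : ℝ) : ℂ)) * f ξ with hg
  have hgi : Integrable g := by
    refine hf.bdd_mul (c := 1) ?_ ?_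
    · have := G.hqm
      apply Measurable.aestronglyMeasurable
      fun_prop
    · exact Filter.Eventually.of_forall fun ξ => (norm_cexp_I _).le
  have h1 : extU volume q id f p = ∫ ξ in ⋃ k, slS K i k, g ξ := by
    have : ∀ᵐ ξ : E3, ξ ∈ (⋃ k, slS K i k) ∨ g ξ = 0 := by
      have h0 : ∀ᵐ ξ : E3, ξ ≠ 0 := by
        simp [ae_iff]
      filter_upwards [h0] with ξ hξ
      by_cases hk : ξ ∈ K
      · left
        apply slS_cover K i hk
        have := G.bound ξ hk
        have h3 : 0 < ‖ξ‖ := norm_pos_iff.2 hξ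
        have h4 := G.hR
        by_contra hcon
        nlinarith
      · right; simp [hg, hfK ξ hk]
    rw [setIntegral_eq_integral_of_ae_compl_eq_zero]
    · rfl
    · filter_upwards [this] with ξ hξ hn
      exact hξ.resolve_left hn
  have h2 := (hasSum_integral_iUnion (fun k => slS_meas G.closed i k) (slS_disj K i) hgi.integrableOn).tsum_eq
  rw [h1, ← h2]
  exact enorm_tsum_le_tsum_enorm

lemma cube_tsum (a : ℤ → ℝ≥0∞) : (∑' k, a k) ^ 3 = ∑' k : ℤ × ℤ × ℤ, a k.1 * a k.2.1 * a k.2.2 := by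
  rw [ENNReal.tsum_prod']
  simp_rw [ENNReal.tsum_prod', ENNReal.tsum_mul_left, ENNReal.tsum_mul_right]
  simp_rw [ENNReal.tsum_mul_left, ENNReal.tsum_mul_right]
  ring

lemma cone_bound {m R : ℝ} {i : Fin 3} {q q1 q2 : E3 → ℝ} {e : E3} {K : Set E3}
    (G : GoodCone m R i q q1 q2 e K) (f : E3 → ℂ) (hf : Integrable f) (hfK : ∀ ξ, ξ ∉ K → f ξ = 0) :
    ∫⁻ p, ‖extU volume q id f p‖ₑ ^ 6 ≤ Bc m R * Cs ^ 4 * (∫⁻ ξ, ‖ξ‖ₑ ^ 2 * ‖f ξ‖ₑ ^ 2) ^ 3 := by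
  have hme : ∀ k, Measurable (fun p => ‖uS q (slS K i k) f p‖ₑ) := fun k =>
    (extU_meas _ q id G.hqm measurable_id f hf.restrict).enorm
  calc ∫⁻ p, ‖extU volume q id f p‖ₑ ^ 6
      ≤ ∫⁻ p, (∑' k : ℤ × ℤ × ℤ, ‖uS q (slS K i k.1) f p‖ₑ * ‖uS q (slS K i k.2.1) f p‖ₑ *
          ‖uS q (slS K i k.2.2) f p‖ₑ) ^ 2 := by
        apply lintegral_mono
        intro p
        simp only
        rw [← cube_tsum (fun k => ‖uS q (slS K i k) f p‖ₑ), ← pow_mul]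
        gcongr
        exact cone_decomp G f hf hfK p
    _ ≤ (∑' k : ℤ × ℤ × ℤ, (∫⁻ p, (‖uS q (slS K i k.1) f p‖ₑ * ‖uS q (slS K i k.2.1) f p‖ₑ *
          ‖uS q (slS K i k.2.2) f p‖ₑ) ^ 2) ^ (1 / 2 : ℝ)) ^ 2 := by
        apply minkowski_sq
        intro k
        exact ((hme _).mul (hme _)).mul (hme _)
    _ ≤ (∑' k : ℤ × ℤ × ℤ, (Bc m R) ^ (1 / 2 : ℝ) * (cw (k.1 - k.2.1) * cw (k.1 - k.2.2) *
          (Hk K i f k.1 * Hk K i f k.2.1 * Hk K i f k.2.2))) ^ 2 := by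
        gcongr ?_ ^ 2
        refine ENNReal.tsum_le_tsum fun k => ?_
        refine (ENNReal.rpow_le_rpow (cone_tri2 G f hf k.1 k.2.1 k.2.2) (by norm_num)).trans (le_of_eq ?_)
        rw [ENNReal.mul_rpow_of_nonneg _ _ (by norm_num), ← ENNReal.rpow_natCast, ← ENNReal.rpow_mul]
        norm_num
    _ ≤ ((Bc m R) ^ (1 / 2 : ℝ) * (Cs ^ 2 * ((∑' k, Hk K i f k ^ 2) ^ (1 / 2 : ℝ)) ^ 3)) ^ 2 := by
        rw [ENNReal.tsum_mul_left]
        gcongr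
        exact triple_sum _
    _ = Bc m R * Cs ^ 4 * (∑' k, Hk K i f k ^ 2) ^ 3 := by
        rw [mul_pow, half_sq, mul_pow, ← pow_mul, ← pow_mul, mul_comm 3 2, pow_mul _ 2 3, half_sq]
        ring
    _ ≤ _ := by
        gcongr
        exact sum_Hk K G.closed i f

/-- squared length -/
def r2 (ξ : E3) : ℝ := (ξ 0) ^ 2 + (ξ 1) ^ 2 + (ξ 2) ^ 2

/-- coordinate dot product -/
def dw (e ξ : E3) : ℝ := ξ 0 * e 0 + ξ 1 * e 1 + ξ 2 * e 2

lemma norm_r2 (ξ : E3) : ‖ξ‖ = Real.sqrt (r2 ξ) := by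
  rw [EuclideanSpace.norm_eq, Fin.sum_univ_three]; simp [r2]

lemma r2_nonneg (ξ : E3) : 0 ≤ r2 ξ := by unfold r2; positivity

lemma pF_eq {F : ℝ} (hF : 1 < F) (ξ : E3) :
    pF F ξ = Real.sqrt (((ξ 0) ^ 2 + (ξ 1) ^ 2 + (F * ξ 2) ^ 2) / (F ^ 2 * r2 ξ)) := by
  have : F * ‖ξ‖ = Real.sqrt (F ^ 2 * r2 ξ) := by
    rw [Real.sqrt_mul (by positivity), Real.sqrt_sq (by linarith), norm_r2]
  rw [pF, this, Real.sqrt_div (by positivity)]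

lemma pF_meas (F : ℝ) : Measurable (pF F) := by
  unfold pF; fun_prop

lemma pF_sq {F : ℝ} (hF : 1 < F) {ξ : E3} (h : 0 < r2 ξ) :
    pF F ξ ^ 2 = 1 / F ^ 2 + (1 - 1 / F ^ 2) * (ξ 2 ^ 2 / r2 ξ) := by
  rw [pF_eq hF, Real.sq_sqrt (by have := r2_nonneg ξ; positivity)]
  have hF0 : F ≠ 0 := by linarith
  have h0 := h.ne'
  have e : (ξ 0) ^ 2 + (ξ 1) ^ 2 = r2 ξ - ξ 2 ^ 2 := by unfold r2; ring
  rw [e]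
  field_simp
  ring

lemma pF_pos {F : ℝ} (hF : 1 < F) {ξ : E3} (h : 0 < r2 ξ) : 0 < pF F ξ := by
  rw [pF_eq hF]
  apply Real.sqrt_pos.2
  apply div_pos _ (by positivity)
  have : r2 ξ ≤ (ξ 0) ^ 2 + (ξ 1) ^ 2 + (F * ξ 2) ^ 2 := by
    unfold r2
    have : 0 ≤ (F ^ 2 - 1) * ξ 2 ^ 2 := mul_nonneg (by nlinarith) (by positivity)
    nlinarith
  linarith

lemma pF_le {F : ℝ} (hF : 1 < F) {ξ : E3} (h : 0 < r2 ξ) : pF F ξ ≤ 1 := by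
  have h1 := pF_sq hF h
  have h2 := pF_pos hF h
  have h3 : ξ 2 ^ 2 / r2 ξ ≤ 1 := by
    rw [div_le_one h]; unfold r2; nlinarith [sq_nonneg (ξ 0), sq_nonneg (ξ 1)]
  have h4 : 0 ≤ 1 - 1 / F ^ 2 := by
    rw [sub_nonneg, div_le_one (by positivity)]; nlinarith
  nlinarith

lemma pF_ge {F : ℝ} (hF : 1 < F) {ξ : E3} (h : 0 < r2 ξ) : 1 / F ^ 2 ≤ pF F ξ ^ 2 := by
  rw [pF_sq hF h]
  have h4 : 0 ≤ 1 - 1 / F ^ 2 := by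
    rw [sub_nonneg, div_le_one (by positivity)]; nlinarith
  have : 0 ≤ (1 - 1 / F ^ 2) * (ξ 2 ^ 2 / r2 ξ) := by positivity
  linarith

/-- first derivative of the half square -/
def Nn (e ξ : E3) : ℝ := ξ 2 * (e 2 * r2 ξ - ξ 2 * dw e ξ) / (r2 ξ) ^ 2

/-- derivative of `pF` in direction `e` -/
def P1 (F : ℝ) (e ξ : E3) : ℝ := (1 - 1 / F ^ 2) * Nn e ξ / pF F ξ

/-- derivative of `Nn` -/
def N2 (e ξ : E3) : ℝ := ((e 2 * r2 ξ - ξ 2 * dw e ξ) ^ 2 +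
  ξ 2 * (- 2 * e 2 * dw e ξ * r2 ξ - ξ 2 * r2 e * r2 ξ + 3 * ξ 2 * dw e ξ ^ 2)) / (r2 ξ) ^ 3

/-- second derivative of `pF` in direction `e` -/
def P2 (F : ℝ) (e ξ : E3) : ℝ :=
  (1 - 1 / F ^ 2) / (pF F ξ) ^ 3 * ((1 / F ^ 2 * (e 2 * r2 ξ - ξ 2 * dw e ξ) ^ 2 + (pF F ξ) ^ 2 *
    (ξ 2 * (- 2 * e 2 * dw e ξ * r2 ξ - ξ 2 * r2 e * r2 ξ + 3 * ξ 2 * dw e ξ ^ 2))) / (r2 ξ) ^ 3)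

lemma der_coord (e ξ : E3) (i : Fin 3) : HasDerivAt (fun s : ℝ => (ξ + s • e) i) (e i) 0 := by
  simpa using ((hasDerivAt_id (0:ℝ)).mul_const (e i)).const_add (ξ i)

lemma der_r2 (e ξ : E3) : HasDerivAt (fun s : ℝ => r2 (ξ + s • e)) (2 * dw e ξ) 0 := by
  unfold r2
  refine ((((der_coord e ξ 0).fun_pow 2).fun_add ((der_coord e ξ 1).fun_pow 2)).fun_add
    ((der_coord e ξ 2).fun_pow 2)).congr_deriv ?_
  simp [dw]; ring

lemma der_dw (e ξ : E3) : HasDerivAt (fun s : ℝ => dw e (ξ + s • e)) (r2 e) 0 := by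
  unfold dw
  refine ((((der_coord e ξ 0).mul_const (e 0)).fun_add ((der_coord e ξ 1).mul_const (e 1))).fun_add
    ((der_coord e ξ 2).mul_const (e 2))).congr_deriv ?_
  simp [r2]; ring

lemma der_Nn (e ξ : E3) (h : 0 < r2 ξ) : HasDerivAt (fun s : ℝ => Nn e (ξ + s • e)) (N2 e ξ) 0 := by
  unfold Nn
  have h1 := der_coord e ξ 2
  have h2 := der_r2 e ξ
  have h3 := der_dw e ξ
  have := (h1.fun_mul ((h2.const_mul (e 2)).fun_sub (h1.fun_mul h3))).fun_div (h2.fun_pow 2)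
    (by simp; exact h.ne')
  refine this.congr_deriv ?_
  have h0 := h.ne'
  simp only [zero_smul, add_zero, N2]
  field_simp
  ring

lemma der_pF {F : ℝ} (hF : 1 < F) (e ξ : E3) (h : 0 < r2 ξ) :
    HasDerivAt (fun s : ℝ => pF F (ξ + s • e)) (P1 F e ξ) 0 := by
  have hF0 : F ≠ 0 := by linarith
  have h0 := h.ne'
  have hp := pF_pos hF h
  have hp' := hp.ne'
  have e1 : (fun s : ℝ => pF F (ξ + s • e)) = fun s : ℝ =>
      Real.sqrt (((ξ + s • e) 0 ^ 2 + (ξ + s • e) 1 ^ 2 + (F * (ξ + s • e) 2) ^ 2) / (F ^ 2 * r2 (ξ + s • e))) := by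
    ext s; rw [pF_eq hF]
  rw [e1]
  have h1 := ((((der_coord e ξ 0).fun_pow 2).fun_add ((der_coord e ξ 1).fun_pow 2)).fun_add
    (((der_coord e ξ 2).const_mul F).fun_pow 2)).fun_div ((der_r2 e ξ).const_mul (F ^ 2)) (by simp; exact ⟨hF0, h0⟩)
  have h2 := h1.sqrt (by
    simp only [zero_smul, add_zero]
    intro hh
    have := pF_eq hF ξ
    rw [hh] at this
    simp at this
    exact hp' this)
  refine h2.congr_deriv ?_
  simp only [zero_smul, add_zero]
  rw [← pF_eq hF, P1, Nn]
  field_simp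
  simp only [r2, dw]
  push_cast
  ring

lemma der_P1 {F : ℝ} (hF : 1 < F) (e ξ : E3) (h : 0 < r2 ξ) :
    HasDerivAt (fun s : ℝ => P1 F e (ξ + s • e)) (P2 F e ξ) 0 := by
  have hF0 : F ≠ 0 := by linarith
  have h0 := h.ne'
  have hp := pF_pos hF h
  have hp' := hp.ne'
  have h1 := ((der_Nn e ξ h).const_mul (1 - 1 / F ^ 2)).fun_div (der_pF hF e ξ h) (by simpa using hp')
  unfold P1
  refine h1.congr_deriv ?_
  simp only [zero_smul, add_zero]
  have hs := pF_sq hF h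
  have hk : P2 F e ξ = (1 - 1 / F ^ 2) / (pF F ξ) ^ 3 * (pF F ξ ^ 2 * N2 e ξ - (1 - 1 / F ^ 2) * Nn e ξ ^ 2) := by
    unfold P2 N2 Nn
    rw [hs]
    field_simp
    ring
  rw [hk, P1]
  field_simp

lemma cont_pF {F : ℝ} (hF : 1 < F) {ξ : E3} (h : 0 < r2 ξ) : ContinuousAt (pF F) ξ := by
  have hn : ‖ξ‖ ≠ 0 := by rw [norm_r2]; exact (Real.sqrt_pos.2 h).ne'
  unfold pF
  apply ContinuousAt.div
  · apply Continuous.continuousAt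
    fun_prop
  · apply Continuous.continuousAt
    fun_prop
  · exact mul_ne_zero (by linarith) hn

/-- lower curvature bound -/
def mF (F : ℝ) : ℝ := (F - 1) / F ^ 3 / 10000

lemma mF_pos {F : ℝ} (hF : 1 < F) : 0 < mF F := by
  unfold mF
  have : 0 < F - 1 := by linarith
  positivity

lemma mF_le1 {F : ℝ} (hF : 1 < F) : mF F ≤ (1 - 1 / F ^ 2) * (1 / F ^ 2) / 10000 := by
  unfold mF
  have hF0 : 0 < F := by linarith
  apply div_le_div_of_nonneg_right _ (by norm_num)
  rw [div_le_iff₀ (by positivity)]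
  have : (1 - 1 / F ^ 2) * (1 / F ^ 2) * F ^ 3 = F - 1 / F := by field_simp
  rw [this]
  have : 1 / F ≤ 1 := by rw [div_le_one hF0]; exact hF.le
  linarith

lemma mF_le2 {F : ℝ} (hF : 1 < F) : mF F ≤ (1 - 1 / F ^ 2) / 10000 := by
  refine (mF_le1 hF).trans ?_
  have h1 : 1 / F ^ 2 ≤ 1 := by rw [div_le_one (by positivity)]; nlinarith
  have h2 : 0 < 1 / F ^ 2 := by positivity
  apply div_le_div_of_nonneg_right _ (by norm_num)
  nlinarith

/-- concavity in horizontal directions -/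
lemma concave_horiz {F : ℝ} (hF : 1 < F) (e ξ : E3) (he : e 2 = 0) (h : 0 < r2 ξ)
    (hz : 0 < ξ 2) (h1 : r2 ξ ≤ 9 * ξ 2 ^ 2) (h2 : ξ 2 ^ 2 * (729 / 10000) ≤ r2 e * r2 ξ - 4 * dw e ξ ^ 2)
    : mF F / (ξ 2) ^ 2 ≤ - P2 F e ξ := by
  have hp := pF_pos hF h
  have hp1 := pF_le hF h
  have hpa := pF_ge hF h
  have hm := mF_le2 hF
  have hmp := mF_pos hF
  set b := 1 - 1 / F ^ 2 with hb
  set a := 1 / F ^ 2 with ha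
  set p := pF F ξ
  set z := ξ 2
  set r := r2 ξ
  set w := dw e ξ
  set E := r2 e
  have hbp : 0 < b := by linarith
  have e1 : - P2 F e ξ = b / p ^ 3 * (z ^ 2 * (p ^ 2 * (E * r - 3 * w ^ 2) - a * w ^ 2) / r ^ 3) := by
    unfold P2
    rw [he]
    ring
  rw [e1]
  have s1 : p ^ 2 * (z ^ 2 * (729 / 10000)) ≤ p ^ 2 * (E * r - 3 * w ^ 2) - a * w ^ 2 := by
    have : p ^ 2 * (z ^ 2 * (729 / 10000)) ≤ p ^ 2 * (E * r - 4 * w ^ 2) := by gcongr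
    nlinarith [sq_nonneg w]
  calc mF F / z ^ 2 ≤ (b / 10000) / z ^ 2 := by gcongr
    _ = b / 1 * (z ^ 2 * (z ^ 2 * (729 / 10000)) / (9 * z ^ 2) ^ 3) := by field_simp; norm_num
    _ ≤ b / p * (z ^ 2 * (z ^ 2 * (729 / 10000)) / r ^ 3) := by gcongr
    _ = b / p ^ 3 * (z ^ 2 * (p ^ 2 * (z ^ 2 * (729 / 10000))) / r ^ 3) := by field_simp
    _ ≤ _ := by gcongr

lemma convex_vert {F : ℝ} (hF : 1 < F) (e ξ : E3) (he : e = !₂[1, 0, -1]) (h : 0 < r2 ξ)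
    (hz : 0 ≤ ξ 2) (hx : 0 < ξ 0) (h1 : 2 * ξ 2 ≤ ξ 0) (h2 : r2 ξ ≤ 9 / 4 * ξ 0 ^ 2) :
    mF F / (ξ 0) ^ 2 ≤ P2 F e ξ := by
  have hp := pF_pos hF h
  have hp1 := pF_le hF h
  have hm := mF_le1 hF
  have hmp := mF_pos hF
  have hm2 := mF_le2 hF
  have e0 : e 0 = 1 := by simp [he]
  have e1 : e 1 = 0 := by simp [he]
  have e2 : e 2 = -1 := by simp [he]
  have hw : dw e ξ = ξ 0 - ξ 2 := by unfold dw; rw [e0, e1, e2]; ring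
  have hE : r2 e = 2 := by unfold r2; rw [e0, e1, e2]; norm_num
  unfold P2
  rw [hw, hE, e2]
  have ha : 0 < 1 / F ^ 2 := by positivity
  set b := 1 - 1 / F ^ 2 with hb
  set a := 1 / F ^ 2
  set p := pF F ξ
  set z := ξ 2
  set x := ξ 0
  set r := r2 ξ
  have hbp : 0 < b := by linarith
  have s1 : 0 ≤ z * (-2 * -1 * (x - z) * r - z * 2 * r + 3 * z * (x - z) ^ 2) := by
    apply mul_nonneg hz
    have : 0 ≤ 2 * (x - 2 * z) * r := by apply mul_nonneg _ h.le; linarith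
    have : 0 ≤ 3 * z * (x - z) ^ 2 := by positivity
    linarith
  have s2 : r ^ 2 ≤ (-1 * r - z * (x - z)) ^ 2 := by
    have : 0 ≤ z * (x - z) := mul_nonneg hz (by linarith)
    nlinarith
  calc mF F / x ^ 2 ≤ (b * a / 10000) / x ^ 2 := by gcongr
    _ ≤ b / 1 * (a / (9 / 4 * x ^ 2)) := by
        rw [div_le_iff₀ (by positivity)]
        field_simp
        norm_num
    _ ≤ b / p ^ 3 * (a / r) := by
        gcongr
        exact pow_le_one₀ hp.le hp1
    _ = b / p ^ 3 * ((a * r ^ 2 + 0) / r ^ 3) := by congr 1; field_simp; ring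
    _ ≤ _ := by
        gcongr
        positivity

/-- half space -/
def hsp (a b c : ℝ) : Set E3 := {ξ | 0 ≤ a * ξ 0 + b * ξ 1 + c * ξ 2}

lemma hsp_closed (a b c : ℝ) : IsClosed (hsp a b c) := by
  apply isClosed_le continuous_const
  fun_prop

lemma hsp_convex (a b c : ℝ) : Convex ℝ (hsp a b c) := by
  have hl : IsLinearMap ℝ (fun ξ : E3 => a * ξ 0 + b * ξ 1 + c * ξ 2) := by
    constructor
    · intro x y; simp; ring
    · intro t x; simp; ring
  exact convex_halfSpace_ge hl 0

/-- first cone -/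
def K1 : Set E3 := hsp 0 0 1 ∩ (hsp 1 0 (-2) ∩ (hsp 1 1 0 ∩ hsp 1 (-1) 0))

/-- second cone -/
def K2 : Set E3 := hsp 0 2 1 ∩ (hsp 0 (-2) 1 ∩ (hsp 1 0 2 ∩ hsp (-1) 0 2))

/-- third cone -/
def K3 : Set E3 := hsp 2 0 (-1) ∩ (hsp (-1) 0 2 ∩ (hsp 0 2 (-1) ∩ hsp 0 (-1) 2))

lemma norm_le_of {ξ : E3} {l : ℝ} (hl : 0 ≤ l) (h : r2 ξ ≤ 9 * l ^ 2) : ‖ξ‖ ≤ 3 * l := by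
  rw [norm_r2]
  apply Real.sqrt_le_iff.2
  constructor
  · positivity
  · nlinarith

lemma K1_good {F : ℝ} (hF : 1 < F) :
    GoodCone (mF F) 3 0 (pF F) (P1 F !₂[1, 0, -1]) (P2 F !₂[1, 0, -1]) !₂[1, 0, -1] K1 := by
  have hb : ∀ ξ ∈ K1, 0 ≤ ξ 2 ∧ 2 * ξ 2 ≤ ξ 0 ∧ 0 ≤ ξ 0 ∧ r2 ξ ≤ 9 / 4 * ξ 0 ^ 2 := by
    rintro ξ ⟨h1, h2, h3, h4⟩
    simp only [hsp, Set.mem_ofPred_eq] at h1 h2 h3 h4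
    refine ⟨by linarith, by linarith, by linarith, ?_⟩
    unfold r2; nlinarith
  have hr : ∀ ξ : E3, 0 < ξ 0 → 0 < r2 ξ := by
    intro ξ h; unfold r2; positivity
  refine ⟨mF_pos hF, by norm_num, pF_meas F, ?_, ?_, ?_, ?_, ?_, ?_, ?_, ?_⟩
  · have := norm_le_of (ξ := !₂[1, 0, -1]) (l := 1) (by norm_num) (by simp [r2]; norm_num)
    simpa using this
  · exact (hsp_closed _ _ _).inter ((hsp_closed _ _ _).inter ((hsp_closed _ _ _).inter (hsp_closed _ _ _)))
  · exact (hsp_convex _ _ _).inter ((hsp_convex _ _ _).inter ((hsp_convex _ _ _).inter (hsp_convex _ _ _)))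
  · intro ξ h
    obtain ⟨h1, h2, h3, h4⟩ := hb ξ h
    exact norm_le_of h3 (by nlinarith)
  · exact fun ξ _ h => cont_pF hF (hr ξ h)
  · exact fun ξ _ h => der_pF hF _ ξ (hr ξ h)
  · exact fun ξ _ h => der_P1 hF _ ξ (hr ξ h)
  · intro ξ h h0
    obtain ⟨h1, h2, h3, h4⟩ := hb ξ h
    exact convex_vert hF _ ξ rfl (hr ξ h0) h1 h0 h2 h4

lemma K2_good {F : ℝ} (hF : 1 < F) :
    GoodCone (mF F) 3 2 (fun ξ => - pF F ξ) (fun ξ => - P1 F !₂[0, 1, 0] ξ)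
      (fun ξ => - P2 F !₂[0, 1, 0] ξ) !₂[0, 1, 0] K2 := by
  have hb : ∀ ξ ∈ K2, 0 ≤ ξ 2 ∧ r2 ξ ≤ 9 * ξ 2 ^ 2 ∧
      ξ 2 ^ 2 * (729 / 10000) ≤ r2 !₂[0, 1, 0] * r2 ξ - 4 * dw !₂[0, 1, 0] ξ ^ 2 := by
    rintro ξ ⟨h1, h2, h3, h4⟩
    simp only [hsp, Set.mem_ofPred_eq] at h1 h2 h3 h4
    have e1 : r2 !₂[0, 1, 0] = 1 := by simp [r2]
    have e2 : dw !₂[0, 1, 0] ξ = ξ 1 := by simp [dw]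
    have y2 : 4 * ξ 1 ^ 2 ≤ ξ 2 ^ 2 := by nlinarith
    have x2 : ξ 0 ^ 2 ≤ 4 * ξ 2 ^ 2 := by nlinarith
    refine ⟨by linarith, ?_, ?_⟩
    · unfold r2; nlinarith
    · rw [e1, e2]; unfold r2; nlinarith [sq_nonneg (ξ 0), sq_nonneg (ξ 2)]
  have hr : ∀ ξ : E3, 0 < ξ 2 → 0 < r2 ξ := by
    intro ξ h; unfold r2; positivity
  refine ⟨mF_pos hF, by norm_num, (pF_meas F).neg, ?_, ?_, ?_, ?_, ?_, ?_, ?_, ?_⟩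
  · have := norm_le_of (ξ := !₂[0, 1, 0]) (l := 1) (by norm_num) (by simp [r2])
    simpa using this
  · exact (hsp_closed _ _ _).inter ((hsp_closed _ _ _).inter ((hsp_closed _ _ _).inter (hsp_closed _ _ _)))
  · exact (hsp_convex _ _ _).inter ((hsp_convex _ _ _).inter ((hsp_convex _ _ _).inter (hsp_convex _ _ _)))
  · intro ξ h
    obtain ⟨h1, h2, h3⟩ := hb ξ h
    exact norm_le_of h1 h2
  · exact fun ξ _ h => (cont_pF hF (hr ξ h)).neg
  · exact fun ξ _ h => (der_pF hF _ ξ (hr ξ h)).fun_neg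
  · exact fun ξ _ h => (der_P1 hF _ ξ (hr ξ h)).fun_neg
  · intro ξ h h0
    obtain ⟨h1, h2, h3⟩ := hb ξ h
    exact concave_horiz hF _ ξ (by simp) (hr ξ h0) h0 h2 h3

lemma K3_good {F : ℝ} (hF : 1 < F) :
    GoodCone (mF F) 3 2 (fun ξ => - pF F ξ) (fun ξ => - P1 F !₂[1, -1, 0] ξ)
      (fun ξ => - P2 F !₂[1, -1, 0] ξ) !₂[1, -1, 0] K3 := by
  have hb : ∀ ξ ∈ K3, 0 ≤ ξ 2 ∧ r2 ξ ≤ 9 * ξ 2 ^ 2 ∧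
      ξ 2 ^ 2 * (729 / 10000) ≤ r2 !₂[1, -1, 0] * r2 ξ - 4 * dw !₂[1, -1, 0] ξ ^ 2 := by
    rintro ξ ⟨h1, h2, h3, h4⟩
    simp only [hsp, Set.mem_ofPred_eq] at h1 h2 h3 h4
    have e1 : r2 !₂[1, -1, 0] = 2 := by simp [r2]; norm_num
    have e2 : dw !₂[1, -1, 0] ξ = ξ 0 - ξ 1 := by simp [dw]; ring
    have hz : 0 ≤ ξ 2 := by linarith
    have y2 : ξ 1 ^ 2 ≤ 4 * ξ 2 ^ 2 := by nlinarith
    have x2 : ξ 0 ^ 2 ≤ 4 * ξ 2 ^ 2 := by nlinarith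
    refine ⟨hz, ?_, ?_⟩
    · unfold r2; nlinarith
    · rw [e1, e2]; unfold r2
      have a1 : 0 ≤ 2 * ξ 0 - ξ 2 := by linarith
      have a2 : 0 ≤ 2 * ξ 2 - ξ 0 := by linarith
      have a3 : 0 ≤ 2 * ξ 1 - ξ 2 := by linarith
      have a4 : 0 ≤ 2 * ξ 2 - ξ 1 := by linarith
      nlinarith [mul_nonneg a1 a2, mul_nonneg a3 a4, mul_nonneg a1 a3, mul_nonneg a2 a4, mul_nonneg a1 a4, mul_nonneg a2 a3]
  have hr : ∀ ξ : E3, 0 < ξ 2 → 0 < r2 ξ := by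
    intro ξ h; unfold r2; positivity
  refine ⟨mF_pos hF, by norm_num, (pF_meas F).neg, ?_, ?_, ?_, ?_, ?_, ?_, ?_, ?_⟩
  · have := norm_le_of (ξ := !₂[1, -1, 0]) (l := 1) (by norm_num) (by simp [r2]; norm_num)
    simpa using this
  · exact (hsp_closed _ _ _).inter ((hsp_closed _ _ _).inter ((hsp_closed _ _ _).inter (hsp_closed _ _ _)))
  · exact (hsp_convex _ _ _).inter ((hsp_convex _ _ _).inter ((hsp_convex _ _ _).inter (hsp_convex _ _ _)))
  · intro ξ h
    obtain ⟨h1, h2, h3⟩ := hb ξ h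
    exact norm_le_of h1 h2
  · exact fun ξ _ h => (cont_pF hF (hr ξ h)).neg
  · exact fun ξ _ h => (der_pF hF _ ξ (hr ξ h)).fun_neg
  · exact fun ξ _ h => (der_P1 hF _ ξ (hr ξ h)).fun_neg
  · intro ξ h h0
    obtain ⟨h1, h2, h3⟩ := hb ξ h
    exact concave_horiz hF _ ξ (by simp) (hr ξ h0) h0 h2 h3

/-- weighted mass -/
def Wt (f : E3 → ℂ) : ℝ≥0∞ := ∫⁻ ξ, ‖ξ‖ₑ ^ 2 * ‖f ξ‖ₑ ^ 2

lemma eLp6 (u : ℝ × E3 → ℂ) : eLpNorm u 6 volume = (∫⁻ p, ‖u p‖ₑ ^ 6) ^ (1 / 6 : ℝ) := by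
  rw [eLpNorm_eq_lintegral_rpow_enorm_toReal (by norm_num) (by norm_num)]
  simp only [ENNReal.toReal_ofNat]
  congr 1
  apply lintegral_congr
  intro p
  exact_mod_cast ENNReal.rpow_natCast _ 6

lemma scale_time (q : E3 → ℝ) (hq : Measurable q) (f : E3 → ℂ) (hf : Integrable f) (c : ℝ) (hc : c ≠ 0) :
    eLpNorm (extU volume (fun ξ => c * q ξ) id f) 6 volume =
      ENNReal.ofReal (|c|⁻¹ ^ (1 / 6 : ℝ)) * eLpNorm (extU volume q id f) 6 volume := by
  have hm := extU_meas volume q id hq measurable_id f hf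
  have e1 : ∀ p, extU volume (fun ξ => c * q ξ) id f p = extU volume q id f (Prod.map (fun t => c * t) id p) := by
    intro p
    unfold extU
    congr 1; ext ξ
    simp only [id, Prod.map]
    congr 5
    ring
  have hmap : Measure.map (Prod.map (fun t : ℝ => c * t) (id : E3 → E3)) (volume : Measure (ℝ × E3)) =
      ENNReal.ofReal |c⁻¹| • (volume : Measure (ℝ × E3)) := by
    rw [Measure.volume_eq_prod, ← Measure.map_prod_map _ _ (by fun_prop) (by fun_prop)]
    rw [Real.map_volume_mul_left hc, Measure.map_id, Measure.prod_smul_left]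
  rw [eLp6, eLp6]
  simp_rw [e1]
  have h2 : ∫⁻ p, ‖extU volume q id f (Prod.map (fun t => c * t) id p)‖ₑ ^ 6 =
      ENNReal.ofReal |c⁻¹| * ∫⁻ p, ‖extU volume q id f p‖ₑ ^ 6 := by
    rw [← lintegral_map (f := fun p => ‖extU volume q id f p‖ₑ ^ 6) (hm.enorm.pow_const 6) (by fun_prop), hmap, lintegral_smul_measure]
    rfl
  rw [h2, ENNReal.mul_rpow_of_nonneg _ _ (by norm_num), abs_inv, ENNReal.ofReal_rpow_of_nonneg (by positivity) (by norm_num)]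

/-- the estimate holds for frequencies in `S` -/
def Good (S : Set E3) : Prop := ∃ C : ℝ≥0∞, C ≠ ⊤ ∧ ∀ F : ℝ, 1 < F → ∀ f : E3 → ℂ, Integrable f →
  (∀ ξ, ξ ∉ S → f ξ = 0) → eLpNorm (extU volume (pF F) id f) 6 volume ≤
    C * ENNReal.ofReal ((mF F)⁻¹ ^ (1 / 6 : ℝ)) * (Wt f) ^ (1 / 2 : ℝ)

lemma Bc_eq {m R : ℝ} (hR : 0 < R) :
    Bc m R = Bc 1 R * ENNReal.ofReal (m⁻¹) := by
  unfold Bc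
  have : ENNReal.ofReal ((2 * (2 * R)) ^ 6 * (2 * Real.pi) * 4 / m) =
    ENNReal.ofReal ((2 * (2 * R)) ^ 6 * (2 * Real.pi) * 4 / 1) * ENNReal.ofReal (m⁻¹) := by
    rw [← ENNReal.ofReal_mul (by positivity)]
    congr 1; ring
  rw [this]; ring

lemma Bc_ne_top (m R : ℝ) : Bc m R ≠ ⊤ := by
  unfold Bc
  have : vB ≠ ⊤ := by unfold vB; exact measure_ball_lt_top.ne
  finiteness

lemma cone_bound' {m R : ℝ} {i : Fin 3} {q q1 q2 : E3 → ℝ} {e : E3} {K : Set E3}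
    (G : GoodCone m R i q q1 q2 e K) (f : E3 → ℂ) (hf : Integrable f) (hfK : ∀ ξ, ξ ∉ K → f ξ = 0) :
    eLpNorm (extU volume q id f) 6 volume ≤
      (Bc 1 R * Cs ^ 4) ^ (1 / 6 : ℝ) * ENNReal.ofReal (m⁻¹ ^ (1 / 6 : ℝ)) * (Wt f) ^ (1 / 2 : ℝ) := by
  have hm := G.hm
  rw [eLp6]
  refine (ENNReal.rpow_le_rpow (cone_bound G f hf hfK) (by norm_num)).trans (le_of_eq ?_)
  rw [Bc_eq G.hR, ← ENNReal.ofReal_rpow_of_nonneg (by positivity) (by norm_num),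
    ← ENNReal.mul_rpow_of_nonneg _ _ (by norm_num), ENNReal.mul_rpow_of_nonneg _ ((_ : ℝ≥0∞) ^ 3) (by norm_num)]
  congr 1
  · congr 1; ring
  · rw [← ENNReal.rpow_natCast, ← ENNReal.rpow_mul, Wt]; norm_num

lemma cst_ne_top : (Bc 1 3 * Cs ^ 4) ^ (1 / 6 : ℝ) ≠ ⊤ := by
  apply ENNReal.rpow_ne_top_of_nonneg (by norm_num)
  have := Bc_ne_top 1 3
  have := Cs_ne_top
  finiteness

lemma neg_pF_norm (F : ℝ) (f : E3 → ℂ) (hf : Integrable f) :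
    eLpNorm (extU volume (pF F) id f) 6 volume = eLpNorm (extU volume (fun ξ => - pF F ξ) id f) 6 volume := by
  have := scale_time (pF F) (pF_meas F) f hf (-1) (by norm_num)
  simp only [neg_one_mul] at this
  rw [this]; simp

lemma good_K1 : Good K1 :=
  ⟨_, cst_ne_top, fun _ hF f hf h => cone_bound' (K1_good hF) f hf h⟩

lemma good_K2 : Good K2 :=
  ⟨_, cst_ne_top, fun F hF f hf h => (neg_pF_norm F f hf).le.trans (cone_bound' (K2_good hF) f hf h)⟩

lemma good_K3 : Good K3 :=
  ⟨_, cst_ne_top, fun F hF f hf h => (neg_pF_norm F f hf).le.trans (cone_bound' (K3_good hF) f hf h)⟩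

lemma Good.mono {S T : Set E3} (h : Good T) (hST : S ⊆ T) : Good S := by
  obtain ⟨C, hC, h⟩ := h
  exact ⟨C, hC, fun F hF f hf hs => h F hF f hf (fun ξ hξ => hs ξ (fun hh => hξ (hST hh)))⟩

lemma Good.union {S T : Set E3} (hS : Good S) (hT : Good T) (hm : MeasurableSet S) : Good (S ∪ T) := by
  obtain ⟨C, hC, h⟩ := hS
  obtain ⟨D, hD, h'⟩ := hT
  refine ⟨C + D, by finiteness, fun F hF f hf hs => ?_⟩
  have i1 := hf.indicator hm
  have i2 := hf.indicator hm.compl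
  have b1 := h F hF _ i1 (fun ξ hξ => Set.indicator_of_notMem hξ f)
  have b2 := h' F hF _ i2 (fun ξ hξ => by
    by_cases hx : ξ ∈ S
    · simp [hx]
    · rw [Set.indicator_of_mem (by exact hx)]
      exact hs ξ (by simp [hx, hξ]))
  have w : ∀ U : Set E3, Wt (U.indicator f) ≤ Wt f := by
    intro U
    unfold Wt
    apply lintegral_mono
    intro ξ
    simp only
    gcongr
    exact enorm_indicator_le_enorm_self _ _
  have e1 : extU volume (pF F) id f = extU volume (pF F) id (S.indicator f) + extU volume (pF F) id (Sᶜ.indicator f) := by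
    ext p
    simp only [Pi.add_apply]
    unfold extU
    have hgi : ∀ f : E3 → ℂ, Integrable f → Integrable (fun ξ => cexp (I * ((⟪p.2, id ξ⟫ + p.1 * pF F ξ : ℝ) : ℂ)) * f ξ) := by
      intro f hf
      refine hf.bdd_mul (c := 1) ?_ ?_
      · have := pF_meas F
        apply Measurable.aestronglyMeasurable
        fun_prop
      · exact Filter.Eventually.of_forall fun ξ => (norm_cexp_I _).le
    rw [← integral_add (hgi _ i1) (hgi _ i2)]
    congr 1; ext ξ
    rw [← mul_add]
    congr 1
    by_cases hx : ξ ∈ S <;> simp [hx]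
  rw [e1]
  have mm : ∀ f : E3 → ℂ, Integrable f → AEStronglyMeasurable (extU volume (pF F) id f) volume := fun f hf =>
    (extU_meas volume (pF F) id (pF_meas F) measurable_id f hf).aestronglyMeasurable
  refine (eLpNorm_add_le (mm _ i1) (mm _ i2) (by norm_num)).trans ((add_le_add b1 b2).trans ?_)
  rw [add_mul, add_mul]
  gcongr <;> exact w _

lemma Good.isom {S : Set E3} (hS : Good S) (L : E3 ≃ₗᵢ[ℝ] E3) (hL : ∀ F ξ, pF F (L ξ) = pF F ξ) :
    Good (L ⁻¹' S) := by
  obtain ⟨C, hC, h⟩ := hS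
  refine ⟨C, hC, fun F hF f hf hs => ?_⟩
  have mp := L.measurePreserving
  have mps := L.symm.measurePreserving
  have i1 : Integrable (fun ξ => f (L.symm ξ)) :=
    mps.integrable_comp_of_integrable hf
  have b1 := h F hF _ i1 (fun ξ hξ => hs _ (by simpa using hξ))
  have w : Wt (fun ξ => f (L.symm ξ)) = Wt f := by
    unfold Wt
    rw [← mps.lintegral_comp_emb L.symm.toHomeomorph.measurableEmbedding (fun ξ => ‖ξ‖ₑ ^ 2 * ‖f ξ‖ₑ ^ 2)]
    apply lintegral_congr
    intro ξ
    have : ‖L.symm ξ‖ₑ = ‖ξ‖ₑ := by simp [← ofReal_norm]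
    rw [this]
  have e1 : extU volume (pF F) id f = extU volume (pF F) id (fun ξ => f (L.symm ξ)) ∘ Prod.map id L := by
    ext p
    simp only [Function.comp, Prod.map]
    unfold extU
    rw [← mp.integral_comp L.toHomeomorph.measurableEmbedding
      (fun ξ => cexp (I * ((⟪L p.2, id ξ⟫ + id p.1 * pF F ξ : ℝ) : ℂ)) * f (L.symm ξ))]
    congr 1; ext ξ
    simp [hL]
  rw [w] at b1
  rw [e1, eLpNorm_comp_measurePreserving]
  · exact b1
  · exact (extU_meas volume (pF F) id (pF_meas F) measurable_id _ i1).aestronglyMeasurable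
  · exact (MeasurePreserving.id volume).prod mp

/-- reflection in a coordinate -/
def flp (i : Fin 3) : E3 ≃ₗᵢ[ℝ] E3 :=
  LinearIsometryEquiv.piLpCongrRight 2 (fun j => if j = i then LinearIsometryEquiv.neg ℝ else LinearIsometryEquiv.refl ℝ ℝ)

/-- swap of the first two coordinates -/
def swp : E3 ≃ₗᵢ[ℝ] E3 := LinearIsometryEquiv.piLpCongrLeft 2 ℝ ℝ (Equiv.swap 0 1)

lemma flp_apply (i j : Fin 3) (ξ : E3) : flp i ξ j = if j = i then - ξ j else ξ j := by
  unfold flp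
  simp
  split_ifs <;> simp

lemma swp_apply (ξ : E3) : swp ξ 0 = ξ 1 ∧ swp ξ 1 = ξ 0 ∧ swp ξ 2 = ξ 2 := by
  unfold swp
  refine ⟨?_, ?_, ?_⟩ <;> simp [Equiv.piCongrLeft', Equiv.swap_apply_of_ne_of_ne]

lemma pF_flp (i : Fin 3) (F : ℝ) (ξ : E3) : pF F (flp i ξ) = pF F ξ := by
  unfold pF
  rw [LinearIsometryEquiv.norm_map, flp_apply, flp_apply, flp_apply]
  fin_cases i <;> simp

lemma pF_swp (F : ℝ) (ξ : E3) : pF F (swp ξ) = pF F ξ := by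
  unfold pF
  obtain ⟨h1, h2, h3⟩ := swp_apply ξ
  rw [LinearIsometryEquiv.norm_map, h1, h2, h3, add_comm (ξ 1 ^ 2)]

lemma good_univ : Good Set.univ := by
  have mh : ∀ a b c, MeasurableSet (hsp a b c) := fun a b c => (hsp_closed a b c).measurableSet
  have g1 : Good (K1 ∪ (K2 ∪ K3)) :=
    good_K1.union (good_K2.union good_K3 ((mh _ _ _).inter ((mh _ _ _).inter ((mh _ _ _).inter (mh _ _ _)))))
      ((mh _ _ _).inter ((mh _ _ _).inter ((mh _ _ _).inter (mh _ _ _))))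
  have g2 : Good (hsp 0 0 1 ∩ (hsp 0 1 0 ∩ hsp 1 (-1) 0)) := by
    refine g1.mono ?_
    rintro ξ ⟨h1, h2, h3⟩
    simp only [hsp, K1, K2, K3, Set.mem_union, Set.mem_inter_iff, Set.mem_ofPred_eq] at *
    by_cases c1 : 2 * ξ 2 ≤ ξ 0
    · left; refine ⟨?_, ?_, ?_, ?_⟩ <;> linarith
    · push Not at c1
      by_cases c2 : 2 * ξ 1 ≤ ξ 2
      · right; left; refine ⟨?_, ?_, ?_, ?_⟩ <;> linarith
      · push Not at c2
        right; right; refine ⟨?_, ?_, ?_, ?_⟩ <;> linarith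
  have g3 : Good (hsp 0 0 1 ∩ (hsp 0 1 0 ∩ hsp 1 0 0)) := by
    refine (g2.union (g2.isom swp pF_swp) ((mh _ _ _).inter ((mh _ _ _).inter (mh _ _ _)))).mono ?_
    rintro ξ ⟨h1, h2, h3⟩
    obtain ⟨s1, s2, s3⟩ := swp_apply ξ
    simp only [hsp, Set.mem_union, Set.mem_inter_iff, Set.mem_ofPred_eq, Set.mem_preimage, s1, s2, s3] at *
    rcases le_total (ξ 0) (ξ 1) with c | c
    · right; refine ⟨?_, ?_, ?_⟩ <;> linarith
    · left; refine ⟨?_, ?_, ?_⟩ <;> linarith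
  have g4 : Good (hsp 0 0 1 ∩ hsp 0 1 0) := by
    refine (g3.union (g3.isom (flp 0) (pF_flp 0)) ((mh _ _ _).inter ((mh _ _ _).inter (mh _ _ _)))).mono ?_
    rintro ξ ⟨h1, h2⟩
    simp only [hsp, Set.mem_union, Set.mem_inter_iff, Set.mem_ofPred_eq, Set.mem_preimage, flp_apply] at *
    simp at *
    rcases le_total (ξ 0) 0 with c | c
    · right; exact ⟨h1, h2, c⟩
    · left; exact ⟨h1, h2, c⟩
  have g5 : Good (hsp 0 0 1) := by
    refine (g4.union (g4.isom (flp 1) (pF_flp 1)) ((mh _ _ _).inter (mh _ _ _))).mono ?_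
    intro ξ h1
    simp only [hsp, Set.mem_union, Set.mem_inter_iff, Set.mem_ofPred_eq, Set.mem_preimage, flp_apply] at *
    simp at *
    rcases le_total (ξ 1) 0 with c | c
    · right; exact ⟨h1, c⟩
    · left; exact ⟨h1, c⟩
  refine (g5.union (g5.isom (flp 2) (pF_flp 2)) (mh _ _ _)).mono ?_
  intro ξ _
  simp only [hsp, Set.mem_union, Set.mem_ofPred_eq, Set.mem_preimage, flp_apply]
  simp
  exact le_total _ _

open scoped FourierTransform in
lemma fourierTf_schwartz (g : SchwartzMap E3 ℂ) :
    ∃ h : SchwartzMap E3 ℂ, ∀ ξ, fourierTf (fun x => g x) ξ = h ((2 * Real.pi)⁻¹ • ξ) := by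
  refine ⟨𝓕 g, fun ξ => ?_⟩
  rw [SchwartzMap.fourier_coe, Real.fourier_eq']
  unfold fourierTf
  congr 1; ext x
  rw [inner_smul_right, smul_eq_mul]
  congr 2
  have := Real.pi_ne_zero
  have h : (-2 * Real.pi * ((2 * Real.pi)⁻¹ * ⟪x, ξ⟫)) = - ⟪x, ξ⟫ := by field_simp
  rw [h]; push_cast; ring

lemma schwartz_weight (h : SchwartzMap E3 ℂ) : Integrable (fun ξ => ‖ξ‖ ^ 2 * ‖h ξ‖ ^ 2) := by
  have h1 := h.integrable_pow_mul volume 2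
  obtain ⟨C, hC⟩ := h.decay 0 0
  have h2 : Integrable (fun ξ => ‖h ξ‖ * (‖ξ‖ ^ 2 * ‖h ξ‖)) := by
    refine h1.bdd_mul (c := C) (h.continuous.norm.aestronglyMeasurable) ?_
    refine Filter.Eventually.of_forall fun ξ => ?_
    have := hC.2 ξ
    simpa using this
  convert h2 using 2
  ring

lemma final_aux (g : SchwartzMap E3 ℂ) : Integrable (fourierTf (fun x => g x)) ∧
    (Wt (fourierTf (fun x => g x))) ^ (1 / 2 : ℝ) = ENNReal.ofReal (sobolevNorm 1 (fun x => g x)) := by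
  obtain ⟨h, hh⟩ := fourierTf_schwartz g
  have hc : (2 * Real.pi)⁻¹ ≠ 0 := by have := Real.pi_pos; positivity
  constructor
  · have : fourierTf (fun x => g x) = fun ξ => h ((2 * Real.pi)⁻¹ • ξ) := funext hh
    rw [this]
    exact h.integrable.comp_smul hc
  · have hintg : Integrable (fun ξ => ‖ξ‖ ^ 2 * ‖fourierTf (fun x => g x) ξ‖ ^ 2) := by
      have h1 := ((schwartz_weight h).comp_smul hc).const_mul ((2 * Real.pi) ^ 2)
      refine h1.congr (Filter.Eventually.of_forall fun ξ => ?_)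
      simp only
      rw [hh, norm_smul, mul_pow, Real.norm_of_nonneg (by positivity)]
      have := Real.pi_ne_zero
      field_simp
    unfold sobolevNorm Wt
    rw [← ENNReal.ofReal_rpow_of_nonneg (integral_nonneg fun ξ => by positivity) (by norm_num)]
    congr 1
    have e : (fun ξ : E3 => ‖ξ‖ ^ (2 * (1:ℝ)) * ‖fourierTf (fun x => g x) ξ‖ ^ 2) =
        (fun ξ => ‖ξ‖ ^ 2 * ‖fourierTf (fun x => g x) ξ‖ ^ 2) := by
      ext ξ
      congr 1
      rw [mul_one]; exact_mod_cast Real.rpow_natCast _ 2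
    rw [e, ofReal_integral_eq_lintegral_ofReal hintg (Filter.Eventually.of_forall fun ξ => by positivity)]
    apply lintegral_congr
    intro ξ
    rw [ENNReal.ofReal_mul (by positivity), ENNReal.ofReal_pow (by positivity),
      ENNReal.ofReal_pow (by positivity), ofReal_norm, ofReal_norm]

theorem strichartz_primitive_homogeneous :
    ∃ C : ℝ, 0 < C ∧ ∀ (ε F : ℝ), 0 < ε → 1 < F → ∀ sgn : ℝ, (sgn = 1 ∨ sgn = -1) →
      ∀ g : SchwartzMap (EuclideanSpace ℝ (Fin 3)) ℂ,
        eLpNorm (fun p : ℝ × EuclideanSpace ℝ (Fin 3) =>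
            ∫ ξ : EuclideanSpace ℝ (Fin 3),
              Complex.exp (Complex.I *
                Complex.ofReal (⟪p.2, ξ⟫ + sgn * (p.1 / ε) * pF F ξ)) *
                fourierTf (fun x => g x) ξ) 6 volume
          ≤ ENNReal.ofReal (C * ε ^ (1 / 6 : ℝ) * F ^ (1 / 2 : ℝ) * (F - 1) ^ (-(1 / 6) : ℝ) *
              sobolevNorm 1 (fun x => g x)) := by
  obtain ⟨C, hC, h⟩ := good_univ
  set k : ℝ := (10000:ℝ) ^ (1 / 6 : ℝ) with hk
  have hkp : 0 < k := by positivity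
  refine ⟨(C.toReal + 1) * k, by positivity, ?_⟩
  intro ε F hε hF sgn hs g
  obtain ⟨hi, hw⟩ := final_aux g
  set f := fourierTf (fun x => g x) with hf
  have hF1 : 0 < F - 1 := by linarith
  have hF0 : 0 < F := by linarith
  have hsa : |sgn| = 1 := by rcases hs with h | h <;> simp [h]
  have hs0 : sgn ≠ 0 := by rcases hs with h | h <;> simp [h]
  have e1 : (fun p : ℝ × EuclideanSpace ℝ (Fin 3) =>
            ∫ ξ : EuclideanSpace ℝ (Fin 3),
              Complex.exp (Complex.I *
                Complex.ofReal (⟪p.2, ξ⟫ + sgn * (p.1 / ε) * pF F ξ)) *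
                f ξ) = extU volume (fun ξ => (sgn / ε) * pF F ξ) id f := by
    ext p
    unfold extU
    congr 1; ext ξ
    simp only [id]
    congr 5
    ring
  rw [e1, scale_time (pF F) (pF_meas F) f hi (sgn / ε) (by positivity)]
  have b := h F hF f hi (fun ξ hξ => absurd (Set.mem_univ ξ) hξ)
  rw [hw] at b
  have hsob : 0 ≤ sobolevNorm 1 (fun x => g x) := by
    unfold sobolevNorm
    exact Real.rpow_nonneg (integral_nonneg fun ξ => by positivity) _
  have em : (mF F)⁻¹ ^ (1 / 6 : ℝ) = k * F ^ (1 / 2 : ℝ) * (F - 1) ^ (-(1 / 6) : ℝ) := by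
    have : (mF F)⁻¹ = 10000 * F ^ (3:ℝ) * (F - 1) ^ (-1 : ℝ) := by
      unfold mF
      rw [Real.rpow_neg_one]
      have : F ^ (3:ℝ) = F ^ 3 := by exact_mod_cast Real.rpow_natCast F 3
      rw [this]
      field_simp
    rw [this, Real.mul_rpow (by positivity) (by positivity), Real.mul_rpow (by positivity) (by positivity),
      ← Real.rpow_mul hF0.le, ← Real.rpow_mul hF1.le]
    norm_num [hk]
  have ec : |sgn / ε|⁻¹ = ε := by
    rw [abs_div, hsa, abs_of_pos hε]; simp
  rw [ec]
  have hC' : C ≤ ENNReal.ofReal (C.toReal + 1) := by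
    rw [← ENNReal.ofReal_toReal hC]
    apply ENNReal.ofReal_le_ofReal
    rw [ENNReal.toReal_ofReal (by positivity)]; linarith
  calc _ ≤ ENNReal.ofReal (ε ^ (1 / 6 : ℝ)) * (C * ENNReal.ofReal ((mF F)⁻¹ ^ (1 / 6 : ℝ)) *
            ENNReal.ofReal (sobolevNorm 1 (fun x => g x))) := by gcongr
    _ ≤ ENNReal.ofReal (ε ^ (1 / 6 : ℝ)) * (ENNReal.ofReal (C.toReal + 1) * ENNReal.ofReal ((mF F)⁻¹ ^ (1 / 6 : ℝ)) *
            ENNReal.ofReal (sobolevNorm 1 (fun x => g x))) := by gcongr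
    _ = _ := by
        have hmp := mF_pos hF
        rw [← ENNReal.ofReal_mul (by positivity), ← ENNReal.ofReal_mul (by positivity),
          ← ENNReal.ofReal_mul (by positivity), em]
        congr 1
        ring

end
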